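/- arXiv:1902.11281 — 5 statements merged into one kernel-verified Lean document; each statement's English description precedes it below -/
import Mathlib

section
/- Let n, m, d be positive integers with d ≤ n, let C, A_1, …, A_m be real n×n matrices, let b_1, …, b_m ∈ ℝ, and let each relation ⊲_i be one of ≤, ≥, =. Consider the semidefinite program SDP(I): minimize ⟨C, X⟩ over real symmetric n×n matrices X subject to ⟨A_i, X⟩ ⊲_i b_i for all 1 ≤ i ≤ m, tr(X) ≤ d, and 0 ⪯ X ⪯ I_n. If the feasible set of SDP(I) is nonempty and the optimum is attained, then every extreme point of the set of optimal solutions of SDP(I) has rank at most d + ⌊√(2m + 9/4) − 3/2⌋. -/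
open Matrix

/-- A real diagonal matrix with nonnegative entries remains positive semidefinite under small
multiples of a symmetric matrix supported on the positive diagonal entries. -/
lemma exists_posSemidef_diagonal_add_smul {ι : Type*} [Fintype ι] [DecidableEq ι]
    {D : ι → ℝ} (hD : ∀ i, 0 ≤ D i) {E : Matrix ι ι ℝ} (hE : E.IsSymm)
    (hsupp : ∀ i j, E i j ≠ 0 → 0 < D i ∧ 0 < D j) :
    ∃ ε > 0, ∀ t : ℝ, |t| ≤ ε → (diagonal D + t • E).PosSemidef := by
  have hb : ∀ i j, ∃ M : ℝ, 0 ≤ M ∧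
      ∀ x y : ℝ, |E i j * x * y| ≤ M * (D i * x ^ 2 + D j * y ^ 2) := by
    intro i j
    by_cases h : E i j = 0
    · exact ⟨0, le_rfl, by simp [h]⟩
    · obtain ⟨hi, hj⟩ := hsupp i j h
      refine ⟨|E i j| * ((D i)⁻¹ + (D j)⁻¹), by positivity, fun x y ↦ ?_⟩
      have hxy : |x * y| ≤ x ^ 2 + y ^ 2 := by
        rw [abs_le]
        constructor <;> nlinarith [sq_nonneg (x + y), sq_nonneg (x - y)]
      have hle : x ^ 2 + y ^ 2 ≤ ((D i)⁻¹ + (D j)⁻¹) * (D i * x ^ 2 + D j * y ^ 2) := by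
        have : ((D i)⁻¹ + (D j)⁻¹) * (D i * x ^ 2 + D j * y ^ 2) =
            x ^ 2 + y ^ 2 + ((D i)⁻¹ * (D j * y ^ 2) + (D j)⁻¹ * (D i * x ^ 2)) := by
          field_simp
          ring
        rw [this]
        have : 0 ≤ (D i)⁻¹ * (D j * y ^ 2) + (D j)⁻¹ * (D i * x ^ 2) := by positivity
        linarith
      rw [mul_assoc, abs_mul, mul_assoc]
      exact mul_le_mul_of_nonneg_left (hxy.trans hle) (abs_nonneg _)
  choose M hM0 hM using hb
  set T : ℝ := ∑ i, ∑ j, (M i j + M j i) with hT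
  have hT0 : 0 ≤ T :=
    Finset.sum_nonneg fun i _ ↦ Finset.sum_nonneg fun j _ ↦ add_nonneg (hM0 i j) (hM0 j i)
  refine ⟨(T + 1)⁻¹, by positivity, fun t ht ↦ ?_⟩
  refine PosSemidef.of_dotProduct_mulVec_nonneg ?_ fun x ↦ ?_
  · rw [IsHermitian, conjTranspose_eq_transpose_of_trivial, transpose_add, transpose_smul,
      diagonal_transpose, hE]
  set q : ℝ := ∑ i, D i * x i ^ 2 with hq
  have hq0 : ∀ i ∈ Finset.univ, 0 ≤ D i * x i ^ 2 :=
    fun i _ ↦ mul_nonneg (hD i) (sq_nonneg _)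
  have hform : star x ⬝ᵥ ((diagonal D + t • E) *ᵥ x) =
      q + t * ∑ i, ∑ j, E i j * x i * x j := by
    rw [add_mulVec, dotProduct_add, smul_mulVec, dotProduct_smul, smul_eq_mul]
    congr 1
    · simp only [dotProduct, mulVec_diagonal, hq, star_trivial]
      exact Finset.sum_congr rfl fun i _ ↦ by ring
    · congr 1
      simp only [dotProduct, mulVec, star_trivial, Finset.mul_sum]
      exact Finset.sum_congr rfl fun i _ ↦ Finset.sum_congr rfl fun j _ ↦ by ring
  have hsum : |∑ i, ∑ j, E i j * x i * x j| ≤ T * q := by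
    calc |∑ i, ∑ j, E i j * x i * x j|
        ≤ ∑ i, ∑ j, |E i j * x i * x j| :=
          (Finset.abs_sum_le_sum_abs _ _).trans
            (Finset.sum_le_sum fun i _ ↦ Finset.abs_sum_le_sum_abs _ _)
      _ ≤ ∑ i, ∑ j, M i j * (q + q) := by
          refine Finset.sum_le_sum fun i _ ↦ Finset.sum_le_sum fun j _ ↦ ?_
          refine (hM i j _ _).trans (mul_le_mul_of_nonneg_left ?_ (hM0 i j))
          exact add_le_add (Finset.single_le_sum hq0 (Finset.mem_univ i))
            (Finset.single_le_sum hq0 (Finset.mem_univ j))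
      _ = T * q := by
          have : ∑ i, ∑ j, M j i = ∑ i, ∑ j, M i j := Finset.sum_comm
          simp only [hT, Finset.sum_add_distrib, this, ← Finset.sum_mul]
          ring
  have hqn : 0 ≤ q := Finset.sum_nonneg hq0
  have hsmall : |t * ∑ i, ∑ j, E i j * x i * x j| ≤ q := by
    rw [abs_mul]
    calc |t| * |∑ i, ∑ j, E i j * x i * x j| ≤ (T + 1)⁻¹ * (T * q) :=
          mul_le_mul ht hsum (abs_nonneg _) (by positivity)
      _ ≤ (T + 1)⁻¹ * ((T + 1) * q) := by gcongr; linarith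
      _ = q := by field_simp
  rw [hform]
  linarith [(abs_le.mp hsmall).1]

/-- The symmetric matrix supported on `S × S` with prescribed entries. -/
def symmMatrixOfSym2 {ι : Type*} [DecidableEq ι] (S : Finset ι) :
    (Sym2 S → ℝ) →ₗ[ℝ] Matrix ι ι ℝ where
  toFun g := Matrix.of fun i j ↦
    if h : i ∈ S ∧ j ∈ S then g s(⟨i, h.1⟩, ⟨j, h.2⟩) else 0
  map_add' f g := by
    ext i j
    by_cases h : i ∈ S ∧ j ∈ S <;> simp [h]
  map_smul' c g := by
    ext i j
    by_cases h : i ∈ S ∧ j ∈ S <;> simp [h]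

/-- Fewer than `|S| (|S| + 1) / 2` linear equations have a nonzero symmetric solution supported
on `S × S`. -/
lemma exists_isSymm_ne_zero_of_card_lt {ι κ : Type*} [DecidableEq ι] [Fintype κ]
    (S : Finset ι) (L : Matrix ι ι ℝ →ₗ[ℝ] (κ → ℝ))
    (h : Fintype.card κ < (S.card + 1).choose 2) :
    ∃ E : Matrix ι ι ℝ, E ≠ 0 ∧ E.IsSymm ∧ (∀ i j, E i j ≠ 0 → i ∈ S ∧ j ∈ S) ∧ L E = 0 := by
  have hker : LinearMap.ker (L ∘ₗ symmMatrixOfSym2 S) ≠ ⊥ := by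
    apply LinearMap.ker_ne_bot_of_finrank_lt
    rw [Module.finrank_fintype_fun_eq_card, Module.finrank_fintype_fun_eq_card, Sym2.card,
      Fintype.card_coe]
    exact h
  obtain ⟨g, hg, hg0⟩ := (Submodule.ne_bot_iff _).mp hker
  refine ⟨symmMatrixOfSym2 S g, fun h0 ↦ hg0 ?_, ?_, fun i j hij ↦ ?_, hg⟩
  · funext z
    induction z with
    | _ a b =>
      have := congrFun (congrFun h0 a) b
      simpa [symmMatrixOfSym2] using this
  · ext i j
    by_cases hi : i ∈ S <;> by_cases hj : j ∈ S <;> simp [symmMatrixOfSym2, hi, hj]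
    exact congrArg g Sym2.eq_swap
  · by_contra hc
    exact hij (by simp [symmMatrixOfSym2, hc])

/-- Orthogonal diagonalization of a real symmetric matrix. -/
lemma exists_orthogonal_diagonalization {ι : Type*} [Fintype ι] [DecidableEq ι]
    {X : Matrix ι ι ℝ} (hX : X.IsSymm) :
    ∃ (U : Matrix ι ι ℝ) (D : ι → ℝ), U * Uᵀ = 1 ∧ Uᵀ * U = 1 ∧ X = U * diagonal D * Uᵀ := by
  have hH : X.IsHermitian := by
    rw [IsHermitian, conjTranspose_eq_transpose_of_trivial, hX]
  refine ⟨hH.eigenvectorUnitary, hH.eigenvalues, ?_, ?_, ?_⟩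
  · have := Unitary.coe_mul_star_self hH.eigenvectorUnitary
    rwa [Unitary.coe_star, star_eq_conjTranspose, conjTranspose_eq_transpose_of_trivial] at this
  · have := Unitary.coe_star_mul_self hH.eigenvectorUnitary
    rwa [star_eq_conjTranspose, conjTranspose_eq_transpose_of_trivial] at this
  · have := hH.spectral_theorem
    rw [Unitary.conjStarAlgAut_apply, star_eq_conjTranspose,
      conjTranspose_eq_transpose_of_trivial] at this
    exact this

lemma rank_orthogonal_conj_diagonal {ι : Type*} [Fintype ι] [DecidableEq ι]
    {U : Matrix ι ι ℝ} (hU : U * Uᵀ = 1) (D : ι → ℝ) :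
    (U * diagonal D * Uᵀ).rank = (Finset.univ.filter fun i ↦ D i ≠ 0).card := by
  have hdet : IsUnit U.det := isUnit_det_of_right_inverse hU
  rw [rank_mul_eq_left_of_isUnit_det _ _ (isUnit_det_transpose U hdet),
    rank_mul_eq_right_of_isUnit_det _ _ hdet, rank_diagonal, Fintype.card_subtype]

/-- If numbers in `[0, 1]` sum to at most `d` and `f` of them lie strictly between `0` and `1`,
then at most `d + (f - 1)` of them are nonzero (with truncated subtraction). -/
lemma card_ne_zero_le_of_sum_le {ι : Type*} [Fintype ι] [DecidableEq ι] {D : ι → ℝ}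
    (h0 : ∀ i, 0 ≤ D i) (h1 : ∀ i, D i ≤ 1) {d : ℕ} (hd : ∑ i, D i ≤ d) :
    (Finset.univ.filter fun i ↦ D i ≠ 0).card ≤
      d + ((Finset.univ.filter fun i ↦ 0 < D i ∧ D i < 1).card - 1) := by
  set S := Finset.univ.filter fun i ↦ 0 < D i ∧ D i < 1 with hS
  set K := Finset.univ.filter fun i ↦ D i = 1 with hK
  have hdisj : Disjoint K S := by
    rw [Finset.disjoint_left]
    intro i hi hi'
    simp only [hK, hS, Finset.mem_filter] at hi hi'
    linarith [hi.2, hi'.2.2]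
  have hunion : (Finset.univ.filter fun i ↦ D i ≠ 0) = K ∪ S := by
    ext i
    simp only [hK, hS, Finset.mem_filter, Finset.mem_union, Finset.mem_univ, true_and]
    constructor
    · intro hi
      rcases (h1 i).eq_or_lt with h | h
      · exact Or.inl h
      · exact Or.inr ⟨lt_of_le_of_ne (h0 i) hi.symm, h⟩
    · rintro (h | h)
      · simp [h]
      · exact h.1.ne'
  rw [hunion, Finset.card_union_of_disjoint hdisj]
  have hKsum : ∑ i ∈ K, D i = K.card := by
    rw [Finset.sum_congr rfl fun i hi ↦ (Finset.mem_filter.mp hi).2, Finset.sum_const,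
      nsmul_one]
  have hle : ∑ i ∈ K, D i + ∑ i ∈ S, D i ≤ d := by
    rw [← Finset.sum_union hdisj]
    exact (Finset.sum_le_univ_sum_of_nonneg h0).trans hd
  rcases S.eq_empty_or_nonempty with hemp | hne
  · have : (K.card : ℝ) ≤ d := by
      rw [hemp, hKsum] at hle
      simpa using hle
    have : K.card ≤ d := by exact_mod_cast this
    simp [hemp, this]
  · have hpos : 0 < ∑ i ∈ S, D i :=
      Finset.sum_pos (fun i hi ↦ (Finset.mem_filter.mp hi).2.1) hne
    have : (K.card : ℝ) < d := by linarith
    have : K.card < d := by exact_mod_cast this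
    have := hne.card_pos
    omega

lemma sub_one_le_floor_sqrt {f m : ℕ} (h : (f + 1).choose 2 ≤ m + 1) :
    f - 1 ≤ ⌊Real.sqrt (2 * (m : ℝ) + 9 / 4) - 3 / 2⌋₊ := by
  rcases f with _ | f
  · simp
  apply Nat.le_floor
  have hle : ((f : ℝ) + 2) * (f + 1) ≤ 2 * (m + 1) := by
    have hc : ((f + 1 + 1).choose 2 : ℝ) ≤ m + 1 := by exact_mod_cast h
    rw [Nat.cast_choose_two] at hc
    push_cast at hc
    linarith
  have : (f : ℝ) + 3 / 2 ≤ Real.sqrt (2 * (m : ℝ) + 9 / 4) :=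
    Real.le_sqrt_of_sq_le (by nlinarith)
  simp only [Nat.add_sub_cancel]
  linarith

/-- Any extreme point of the set of optimal solutions of the SDP
`min ⟨C,X⟩ s.t. ⟨A_i,X⟩ ⊲_i b_i, tr(X) ≤ d, 0 ⪯ X ⪯ I` has rank at most
`d + ⌊√(2m + 9/4) − 3/2⌋`. -/
theorem stmt0 {n m d : ℕ} (hn : 0 < n) (hm : 0 < m) (hd : 0 < d) (hdn : d ≤ n)
    (C : Matrix (Fin n) (Fin n) ℝ) (A : Fin m → Matrix (Fin n) (Fin n) ℝ)
    (b : Fin m → ℝ) (rel : Fin m → ℝ → ℝ → Prop)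
    (hrel : ∀ i, rel i = (· ≤ ·) ∨ rel i = (· ≥ ·) ∨ rel i = (· = ·))
    (Feas : Set (Matrix (Fin n) (Fin n) ℝ))
    (hFeas : Feas = {X | X.IsSymm ∧ (∀ i, rel i ((A i)ᵀ * X).trace (b i)) ∧
      X.trace ≤ (d : ℝ) ∧ X.PosSemidef ∧ ((1 : Matrix (Fin n) (Fin n) ℝ) - X).PosSemidef})
    (hne : Feas.Nonempty)
    (Opt : Set (Matrix (Fin n) (Fin n) ℝ))
    (hOpt : Opt = {X ∈ Feas | ∀ Y ∈ Feas, (Cᵀ * X).trace ≤ (Cᵀ * Y).trace})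
    (hatt : Opt.Nonempty) :
    ∀ X ∈ Opt.extremePoints ℝ,
      X.rank ≤ d + ⌊Real.sqrt (2 * (m : ℝ) + 9 / 4) - 3 / 2⌋₊ := by
  classical
  intro X hX
  obtain ⟨hXopt, hXext⟩ := mem_extremePoints.mp hX
  have hXF : X ∈ Feas := by rw [hOpt] at hXopt; exact hXopt.1
  have hXmin : ∀ Y ∈ Feas, (Cᵀ * X).trace ≤ (Cᵀ * Y).trace := by
    rw [hOpt] at hXopt; exact hXopt.2
  have hXF' := hXF
  rw [hFeas] at hXF'
  obtain ⟨hsymm, hrelX, htr, hpos, hone⟩ := hXF'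
  obtain ⟨U, D, hU, hU', hXU⟩ := exists_orthogonal_diagonalization hsymm
  have hconj : ∀ M : Matrix (Fin n) (Fin n) ℝ, M.PosSemidef → (U * M * Uᵀ).PosSemidef := by
    intro M hM
    simpa using hM.mul_mul_conjTranspose_same U
  have hdiag : Uᵀ * X * U = diagonal D := by
    rw [hXU]
    calc Uᵀ * (U * diagonal D * Uᵀ) * U = (Uᵀ * U) * diagonal D * (Uᵀ * U) := by
          simp only [Matrix.mul_assoc]
      _ = diagonal D := by simp [hU']
  have hone_sub (N : Matrix (Fin n) (Fin n) ℝ) : U * (1 - N) * Uᵀ = 1 - U * N * Uᵀ := by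
    rw [Matrix.mul_sub, Matrix.sub_mul, Matrix.mul_one, hU]
  have hdiag' : diagonal (fun i ↦ 1 - D i) = 1 - diagonal D := by
    rw [← diagonal_one, diagonal_sub]
  have hD0 : ∀ i, 0 ≤ D i := by
    rw [← posSemidef_diagonal_iff, ← hdiag]
    simpa using hpos.conjTranspose_mul_mul_same U
  have hD1 : ∀ i, 0 ≤ 1 - D i := by
    rw [← posSemidef_diagonal_iff (d := fun i ↦ 1 - D i), hdiag', ← hdiag, ← hU']
    simpa [Matrix.mul_sub, Matrix.sub_mul] using hone.conjTranspose_mul_mul_same U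
  have htrace_conj (N : Matrix (Fin n) (Fin n) ℝ) : (U * N * Uᵀ).trace = N.trace := by
    rw [trace_mul_comm, ← Matrix.mul_assoc, hU', Matrix.one_mul]
  have hsum : ∑ i, D i ≤ d := by
    rwa [hXU, htrace_conj, trace_diagonal] at htr
  set S := Finset.univ.filter fun i ↦ 0 < D i ∧ D i < 1 with hS
  have hrank : X.rank ≤ d + (S.card - 1) := by
    rw [hXU, rank_orthogonal_conj_diagonal hU]
    exact card_ne_zero_le_of_sum_le hD0 (fun i ↦ by linarith [hD1 i]) hsum
  refine hrank.trans (Nat.add_le_add_left (sub_one_le_floor_sqrt ?_) d)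
  by_contra! hcard
  let L : Matrix (Fin n) (Fin n) ℝ →ₗ[ℝ] (Option (Fin m) → ℝ) :=
    { toFun := fun E o ↦ o.elim E.trace fun i ↦ ((A i)ᵀ * (U * E * Uᵀ)).trace
      map_add' := fun E F ↦ by
        funext o
        cases o <;> simp [Matrix.mul_add, Matrix.add_mul]
      map_smul' := fun c E ↦ by
        funext o
        cases o <;> simp }
  obtain ⟨E, hE0, hEsymm, hEsupp, hLE⟩ :=
    exists_isSymm_ne_zero_of_card_lt S L (by simpa using hcard)
  have hEtr : E.trace = 0 := congrFun hLE none
  have hEA : ∀ i, ((A i)ᵀ * (U * E * Uᵀ)).trace = 0 := fun i ↦ congrFun hLE (some i)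
  have hEsupp' : ∀ i j, E i j ≠ 0 → (0 < D i ∧ D i < 1) ∧ (0 < D j ∧ D j < 1) := by
    intro i j hij
    simpa [hS] using hEsupp i j hij
  obtain ⟨ε₁, hε₁, hP₁⟩ := exists_posSemidef_diagonal_add_smul hD0 hEsymm
    fun i j hij ↦ ⟨(hEsupp' i j hij).1.1, (hEsupp' i j hij).2.1⟩
  obtain ⟨ε₂, hε₂, hP₂⟩ := exists_posSemidef_diagonal_add_smul hD1 hEsymm
    fun i j hij ↦ ⟨sub_pos.mpr (hEsupp' i j hij).1.2, sub_pos.mpr (hEsupp' i j hij).2.2⟩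
  set Δ := U * E * Uᵀ with hΔ
  have hXt (t : ℝ) : X + t • Δ = U * (diagonal D + t • E) * Uᵀ := by
    rw [hXU, hΔ, Matrix.mul_add, Matrix.add_mul, Matrix.mul_smul, Matrix.smul_mul]
  have hfeas : ∀ t : ℝ, |t| ≤ min ε₁ ε₂ → X + t • Δ ∈ Feas := by
    intro t ht
    rw [hFeas]
    have hPSD : (X + t • Δ).PosSemidef := by
      rw [hXt]
      exact hconj _ (hP₁ t (ht.trans (min_le_left _ _)))
    refine ⟨?_, fun i ↦ ?_, ?_, hPSD, ?_⟩
    · simpa [IsHermitian, IsSymm, conjTranspose_eq_transpose_of_trivial] using hPSD.isHermitian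
    · rw [Matrix.mul_add, trace_add, Matrix.mul_smul, trace_smul, hEA i, smul_zero, add_zero]
      exact hrelX i
    · rw [trace_add, trace_smul, hΔ, htrace_conj, hEtr, smul_zero, add_zero]
      exact htr
    · rw [hXt, ← hone_sub]
      have := hP₂ (-t) (by rw [abs_neg]; exact ht.trans (min_le_right _ _))
      rw [hdiag', neg_smul, ← sub_eq_add_neg, sub_sub] at this
      exact hconj _ this
  set ε := min ε₁ ε₂ with hε
  have hεpos : 0 < ε := lt_min hε₁ hε₂
  have hobj (t : ℝ) : (Cᵀ * (X + t • Δ)).trace = (Cᵀ * X).trace + t * (Cᵀ * Δ).trace := by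
    rw [Matrix.mul_add, trace_add, Matrix.mul_smul, trace_smul, smul_eq_mul]
  have hF₁ := hfeas ε (abs_of_pos hεpos).le
  have hF₂ := hfeas (-ε) (by rw [abs_neg, abs_of_pos hεpos])
  have hCΔ : ε * (Cᵀ * Δ).trace = 0 := by
    have h₁ := hXmin _ hF₁
    have h₂ := hXmin _ hF₂
    rw [hobj] at h₁ h₂
    linarith
  have hO₁ : X + ε • Δ ∈ Opt := by
    rw [hOpt]
    refine ⟨hF₁, fun Y hY ↦ ?_⟩
    rw [hobj, hCΔ, add_zero]
    exact hXmin Y hY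
  have hO₂ : X + (-ε) • Δ ∈ Opt := by
    rw [hOpt]
    refine ⟨hF₂, fun Y hY ↦ ?_⟩
    rw [hobj, neg_mul, hCΔ, neg_zero, add_zero]
    exact hXmin Y hY
  have hmid : X ∈ openSegment ℝ (X + ε • Δ) (X + (-ε) • Δ) := by
    refine ⟨1 / 2, 1 / 2, by norm_num, by norm_num, by norm_num, ?_⟩
    module
  have hΔ0 : ε • Δ = 0 := by
    simpa using (hXext _ hO₁ _ hO₂ hmid).1
  have hΔ0' : Δ = 0 := (smul_eq_zero.mp hΔ0).resolve_left hεpos.ne'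
  apply hE0
  calc E = (Uᵀ * U) * E * (Uᵀ * U) := by simp [hU']
    _ = Uᵀ * Δ * U := by rw [hΔ]; simp only [Matrix.mul_assoc]
    _ = 0 := by simp [hΔ0']
end

section
/- Let A_1 ∈ ℝ^{m_1×n} and A_2 ∈ ℝ^{m_2×n} be data matrices of two groups and let d ≤ n be a positive integer. Consider the Fair-PCA SDP relaxation: maximize z over z ∈ ℝ and real symmetric n×n matrices X subject to ⟨A_iᵀA_i, X⟩ ≥ z for i = 1, 2, tr(X) ≤ d, and 0 ⪯ X ⪯ I_n. Then any extreme point (z*, X*) of the set of optimal solutions of this SDP satisfies rank(X*) ≤ d. Consequently, the optimal value of this relaxation equals the optimum of exact Fair-PCA with two groups, max over P ∈ P_d of min{‖A_1P‖_F², ‖A_2P‖_F²}. -/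
open Matrix

section Spectral

variable {ι : Type*} [DecidableEq ι]

/-- The symmetric trace-free matrix supported on the coordinates `i, j`. -/
def planePerturbation (i j : ι) (a b : ℝ) : Matrix ι ι ℝ :=
  a • (single i i 1 - single j j 1) + b • (single i j 1 + single j i 1)

lemma planePerturbation_smul (i j : ι) (a b t : ℝ) :
    planePerturbation i j (t * a) (t * b) = t • planePerturbation i j a b := by
  simp [planePerturbation, mul_smul]

lemma transpose_planePerturbation (i j : ι) (a b : ℝ) :
    (planePerturbation i j a b)ᵀ = planePerturbation i j a b := by
  simp [planePerturbation, add_comm (single j i b)]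

lemma planePerturbation_eq_zero {i j : ι} (hij : i ≠ j) {a b : ℝ}
    (h : planePerturbation i j a b = 0) : a = 0 ∧ b = 0 := by
  constructor
  · simpa [planePerturbation, single, hij, hij.symm] using congr_fun₂ h i i
  · simpa [planePerturbation, single, hij, hij.symm] using congr_fun₂ h i j

variable [Fintype ι]

/-- A real matrix `X` with `0 ⪯ X ⪯ 1` is orthogonally diagonalizable with eigenvalues in
`[0, 1]`. -/
lemma exists_orthogonal_diagonalization_s2 {X : Matrix ι ι ℝ} (hX : X.PosSemidef)
    (hX1 : (1 - X).PosSemidef) :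
    ∃ (U : Matrix ι ι ℝ) (w : ι → ℝ), Uᵀ * U = 1 ∧ U * Uᵀ = 1 ∧ X = U * diagonal w * Uᵀ ∧
      (∀ i, 0 ≤ w i) ∧ (∀ i, w i ≤ 1) ∧ X.trace = ∑ i, w i ∧
      X.rank = (Finset.univ.filter fun i => w i ≠ 0).card := by
  have hU : (hX.1.eigenvectorUnitary : Matrix ι ι ℝ)ᵀ * hX.1.eigenvectorUnitary = 1 := by
    simpa [star_eq_conjTranspose] using Unitary.coe_star_mul_self hX.1.eigenvectorUnitary
  have hU' : (hX.1.eigenvectorUnitary : Matrix ι ι ℝ) * (hX.1.eigenvectorUnitary : Matrix ι ι ℝ)ᵀ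
      = 1 := by
    simpa [star_eq_conjTranspose] using Unitary.coe_mul_star_self hX.1.eigenvectorUnitary
  have hspec : X = (hX.1.eigenvectorUnitary : Matrix ι ι ℝ) * diagonal hX.1.eigenvalues *
      (hX.1.eigenvectorUnitary : Matrix ι ι ℝ)ᵀ := by
    have h := hX.1.spectral_theorem
    rw [Unitary.conjStarAlgAut_apply] at h
    simpa [star_eq_conjTranspose, Function.comp_def] using h
  refine ⟨hX.1.eigenvectorUnitary, hX.1.eigenvalues, hU, hU', hspec, hX.eigenvalues_nonneg, ?_,
    by simpa using hX.1.trace_eq_sum_eigenvalues, ?_⟩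
  · intro i
    have h := hX1.conjTranspose_mul_mul_same (hX.1.eigenvectorUnitary : Matrix ι ι ℝ)
    generalize (hX.1.eigenvectorUnitary : Matrix ι ι ℝ) = U at hU hU' hspec h
    have e : Uᴴ * (1 - X) * U = diagonal (fun i => 1 - hX.1.eigenvalues i) := by
      rw [conjTranspose_eq_transpose_of_trivial, mul_sub, sub_mul, mul_one, hU]
      conv_lhs => rw [hspec]
      rw [show Uᵀ * (U * diagonal hX.1.eigenvalues * Uᵀ) * U
        = (Uᵀ * U) * diagonal hX.1.eigenvalues * (Uᵀ * U) by simp only [Matrix.mul_assoc], hU,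
        one_mul, mul_one, ← diagonal_one, diagonal_sub]
    rw [e] at h
    linarith [posSemidef_diagonal_iff.1 h i]
  · rw [hX.1.rank_eq_card_non_zero_eigs, Fintype.card_subtype]

lemma trace_planePerturbation {i j : ι} (hij : i ≠ j) (a b : ℝ) :
    (planePerturbation i j a b).trace = 0 := by
  simp [planePerturbation, trace_single_eq_of_ne _ _ _ hij, trace_single_eq_of_ne _ _ _ hij.symm]

lemma posSemidef_diagonal_add_planePerturbation {w : ι → ℝ} (hw : ∀ l, 0 ≤ w l) {i j : ι}
    (hij : i ≠ j) {a b : ℝ} (hi : |a| + |b| ≤ w i) (hj : |a| + |b| ≤ w j) :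
    (diagonal w + planePerturbation i j a b).PosSemidef := by
  refine .of_dotProduct_mulVec_nonneg ?_ fun x => ?_
  · rw [IsHermitian, conjTranspose_eq_transpose_of_trivial, transpose_add, diagonal_transpose,
      transpose_planePerturbation]
  have hquad : star x ⬝ᵥ (diagonal w + planePerturbation i j a b) *ᵥ x =
      ∑ l, w l * x l ^ 2 + (a * (x i ^ 2 - x j ^ 2) + b * (2 * x i * x j)) := by
    have hd : x ⬝ᵥ diagonal w *ᵥ x = ∑ l, w l * x l ^ 2 := by
      simp only [dotProduct, mulVec_diagonal]
      exact Finset.sum_congr rfl fun l _ => by ring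
    have hs (k l : ι) : x ⬝ᵥ single k l (1 : ℝ) *ᵥ x = x k * x l := by
      rw [single_mulVec, dotProduct_comm]
      simp [Function.update_apply, dotProduct, mul_comm]
    simp only [star_trivial, planePerturbation, add_mulVec, smul_mulVec, sub_mulVec,
      dotProduct_add, dotProduct_smul, dotProduct_sub, hd, hs, smul_eq_mul]
    ring
  have hsum : w i * x i ^ 2 + w j * x j ^ 2 ≤ ∑ l, w l * x l ^ 2 := by
    rw [← Finset.sum_pair (f := fun l => w l * x l ^ 2) hij]
    exact Finset.sum_le_univ_sum_of_nonneg fun l => mul_nonneg (hw l) (sq_nonneg _)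
  rw [hquad]
  have h1 := mul_le_mul_of_nonneg_right hi (sq_nonneg (x i))
  have h2 := mul_le_mul_of_nonneg_right hj (sq_nonneg (x j))
  have h3 : -(|a| * (x i ^ 2 + x j ^ 2)) ≤ a * (x i ^ 2 - x j ^ 2) := by
    nlinarith [mul_nonneg (neg_le_iff_add_nonneg.1 (neg_abs_le a)) (sq_nonneg (x i)),
      mul_nonneg (sub_nonneg.2 (le_abs_self a)) (sq_nonneg (x j))]
  have h4 : -(|b| * (x i ^ 2 + x j ^ 2)) ≤ b * (2 * x i * x j) := by
    nlinarith [mul_nonneg (neg_le_iff_add_nonneg.1 (neg_abs_le b)) (sq_nonneg (x i + x j)),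
      mul_nonneg (sub_nonneg.2 (le_abs_self b)) (sq_nonneg (x i - x j))]
  linarith

/-- If two eigenvalues of `U * diagonal w * Uᵀ` are strictly between `0` and `1`, then the matrix
can be moved a little within `0 ⪯ X ⪯ 1` in the plane of the two eigenvectors. -/
lemma posSemidef_conj_diagonal_add_planePerturbation {U : Matrix ι ι ℝ} (hU : U * Uᵀ = 1)
    {w : ι → ℝ} (hw0 : ∀ l, 0 ≤ w l) (hw1 : ∀ l, w l ≤ 1) {i j : ι} (hij : i ≠ j) {a b : ℝ}
    (hi : |a| + |b| ≤ w i) (hj : |a| + |b| ≤ w j) (hi' : |a| + |b| ≤ 1 - w i)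
    (hj' : |a| + |b| ≤ 1 - w j) :
    (U * diagonal w * Uᵀ + U * planePerturbation i j a b * Uᵀ).PosSemidef ∧
      (1 - (U * diagonal w * Uᵀ + U * planePerturbation i j a b * Uᵀ)).PosSemidef := by
  constructor
  · have h := (posSemidef_diagonal_add_planePerturbation hw0 hij hi hj).mul_mul_conjTranspose_same U
    rwa [conjTranspose_eq_transpose_of_trivial, mul_add, add_mul] at h
  · have h := (posSemidef_diagonal_add_planePerturbation (w := fun l => 1 - w l)
      (fun l => sub_nonneg.2 (hw1 l)) hij (a := -a) (b := -b) (by simpa using hi')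
      (by simpa using hj')).mul_mul_conjTranspose_same U
    have e : diagonal (fun l => 1 - w l) + planePerturbation i j (-a) (-b) =
        1 - (diagonal w + planePerturbation i j a b) := by
      rw [← diagonal_one, ← diagonal_sub, ← neg_one_mul a, ← neg_one_mul b, planePerturbation_smul]
      module
    rwa [e, conjTranspose_eq_transpose_of_trivial, mul_sub, sub_mul, mul_one, hU, mul_add,
      add_mul] at h

lemma trace_conj_orthogonal {U : Matrix ι ι ℝ} (hU : Uᵀ * U = 1) (S : Matrix ι ι ℝ) :
    (U * S * Uᵀ).trace = S.trace := by
  rw [trace_mul_comm, ← Matrix.mul_assoc, hU, one_mul]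

lemma conj_orthogonal_eq_zero {U S : Matrix ι ι ℝ} (hU : Uᵀ * U = 1)
    (h : U * S * Uᵀ = 0) : S = 0 := by
  calc S = (Uᵀ * U) * S * (Uᵀ * U) := by rw [hU, one_mul, mul_one]
    _ = Uᵀ * (U * S * Uᵀ) * U := by simp only [Matrix.mul_assoc]
    _ = 0 := by rw [h]; simp

/-- Two linear functionals agree on some nonzero trace-free symmetric perturbation of a plane. -/
lemma exists_planePerturbation_trace_eq (U B₁ B₂ : Matrix ι ι ℝ) (i j : ι) :
    ∃ a b : ℝ, (a ≠ 0 ∨ b ≠ 0) ∧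
      (B₁ * (U * planePerturbation i j a b * Uᵀ)).trace =
        (B₂ * (U * planePerturbation i j a b * Uᵀ)).trace := by
  have key (B : Matrix ι ι ℝ) (a b : ℝ) : (B * (U * planePerturbation i j a b * Uᵀ)).trace =
      a * (B * (U * planePerturbation i j 1 0 * Uᵀ)).trace +
      b * (B * (U * planePerturbation i j 0 1 * Uᵀ)).trace := by
    have e : planePerturbation i j a b =
        a • planePerturbation i j 1 0 + b • planePerturbation i j 0 1 := by
      simp only [planePerturbation]
      module
    rw [e]
    simp only [mul_add, add_mul, Matrix.mul_smul, Matrix.smul_mul, trace_add, trace_smul,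
      smul_eq_mul]
  by_cases h : (B₁ * (U * planePerturbation i j 1 0 * Uᵀ)).trace =
      (B₂ * (U * planePerturbation i j 1 0 * Uᵀ)).trace
  · exact ⟨1, 0, by simp, h⟩
  · refine ⟨(B₁ * (U * planePerturbation i j 0 1 * Uᵀ)).trace -
      (B₂ * (U * planePerturbation i j 0 1 * Uᵀ)).trace,
      (B₂ * (U * planePerturbation i j 1 0 * Uᵀ)).trace -
      (B₁ * (U * planePerturbation i j 1 0 * Uᵀ)).trace, .inr (sub_ne_zero.2 (Ne.symm h)), ?_⟩
    rw [key B₁ (_ - _) (_ - _), key B₂ (_ - _) (_ - _)]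
    ring

end Spectral

/-- If at most one of finitely many weights in `[0, 1]` is fractional, the number of nonzero weights
is at most any integer bounding their sum. -/
lemma card_ne_zero_le_of_sum_le_s2 {ι : Type*} [Fintype ι] {w : ι → ℝ} {d : ℕ}
    (hw0 : ∀ i, 0 ≤ w i) (hfrac : ∀ i j, w i ≠ 0 → w i ≠ 1 → w j ≠ 0 → w j ≠ 1 → i = j)
    (hsum : ∑ i, w i ≤ d) : (Finset.univ.filter fun i => w i ≠ 0).card ≤ d := by
  classical
  set N := Finset.univ.filter fun i => w i ≠ 0 with hN
  have hNsum : ∑ i ∈ N, w i ≤ d :=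
    (Finset.sum_le_univ_sum_of_nonneg hw0).trans hsum
  by_cases h : ∃ i ∈ N, w i ≠ 1
  · obtain ⟨i, hi, hi1⟩ := h
    have hi0 : w i ≠ 0 := by simpa [hN] using hi
    have hrest : ∑ l ∈ N.erase i, w l = ((N.erase i).card : ℝ) := by
      rw [Finset.card_eq_sum_ones, Nat.cast_sum]
      refine Finset.sum_congr rfl fun l hl => ?_
      by_contra hl1
      obtain ⟨hli, hlN⟩ := Finset.mem_erase.1 hl
      exact hli (hfrac l i (by simpa [hN] using hlN) (by simpa using hl1) hi0 hi1)
    rw [← Finset.add_sum_erase _ _ hi, hrest] at hNsum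
    have hpos : 0 < w i := (hw0 i).lt_of_ne' hi0
    have hlt : ((N.erase i).card : ℝ) < d := by linarith
    have hc := Finset.card_erase_add_one hi
    have := Nat.cast_lt.1 hlt
    omega
  · push Not at h
    rw [Finset.sum_congr rfl h] at hNsum
    simpa using hNsum

/-- The feasible set of the two-group Fair-PCA relaxation. -/
def fairPCAFeasible {n : ℕ} (B₁ B₂ : Matrix (Fin n) (Fin n) ℝ) (d : ℕ) :
    Set (ℝ × Matrix (Fin n) (Fin n) ℝ) :=
  {p | p.2.IsSymm ∧ p.1 ≤ (B₁ * p.2).trace ∧ p.1 ≤ (B₂ * p.2).trace ∧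
    p.2.trace ≤ (d : ℝ) ∧ p.2.PosSemidef ∧ (1 - p.2).PosSemidef}

/-- The optimal set of the two-group Fair-PCA relaxation. -/
def fairPCAOptimal {n : ℕ} (B₁ B₂ : Matrix (Fin n) (Fin n) ℝ) (d : ℕ) :
    Set (ℝ × Matrix (Fin n) (Fin n) ℝ) :=
  {p ∈ fairPCAFeasible B₁ B₂ d | ∀ q ∈ fairPCAFeasible B₁ B₂ d, q.1 ≤ p.1}

section Relaxation

variable {n d : ℕ} {B₁ B₂ : Matrix (Fin n) (Fin n) ℝ}

theorem rank_le_of_mem_extremePoints_fairPCAOptimal {p : ℝ × Matrix (Fin n) (Fin n) ℝ}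
    (hp : p ∈ (fairPCAOptimal B₁ B₂ d).extremePoints ℝ) : p.2.rank ≤ d := by
  obtain ⟨⟨⟨hsymm, hp1, hp2, htr, hpsd, hpsd1⟩, hmax⟩, hext⟩ := mem_extremePoints.1 hp
  obtain ⟨U, w, hU, hU', hX, hw0, hw1, hwtr, hrank⟩ :=
    exists_orthogonal_diagonalization_s2 hpsd hpsd1
  rw [hrank]
  refine card_ne_zero_le_of_sum_le_s2 hw0 (fun i j hi0 hi1 hj0 hj1 => ?_) (hwtr ▸ htr)
  by_contra hij
  obtain ⟨a, b, hab, heq⟩ := exists_planePerturbation_trace_eq U B₁ B₂ i j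
  have hμ : ∃ μ > 0, μ ≤ w i ∧ μ ≤ w j ∧ μ ≤ 1 - w i ∧ μ ≤ 1 - w j := by
    have h1 := (hw0 i).lt_of_ne' hi0
    have h2 := (hw0 j).lt_of_ne' hj0
    have h3 := sub_pos.2 ((hw1 i).lt_of_ne hi1)
    have h4 := sub_pos.2 ((hw1 j).lt_of_ne hj1)
    exact ⟨min (min (w i) (w j)) (min (1 - w i) (1 - w j)), by positivity, by simp, by simp,
      by simp, by simp⟩
  obtain ⟨μ, hμ, hμ1, hμ2, hμ3, hμ4⟩ := hμ
  have hs : 0 < |a| + |b| := by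
    rcases hab with h | h
    · have := abs_pos.2 h; positivity
    · have := abs_pos.2 h; positivity
  set t : ℝ := μ / (|a| + |b|) with ht
  have ht0 : 0 < t := by positivity
  set S := U * planePerturbation i j a b * Uᵀ with hS
  have hfeas (s : ℝ) (hst : |s| = t) :
      (p.1 + s * (B₁ * S).trace, p.2 + s • S) ∈ fairPCAFeasible B₁ B₂ d := by
    have hsS : s • S = U * planePerturbation i j (s * a) (s * b) * Uᵀ := by
      rw [planePerturbation_smul, hS]; simp
    have hbd : |s * a| + |s * b| = μ := by
      rw [abs_mul, abs_mul, ← mul_add, hst, ht]; field_simp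
    have hpos := posSemidef_conj_diagonal_add_planePerturbation hU' hw0 hw1 hij
      (hbd.trans_le hμ1) (hbd.trans_le hμ2) (hbd.trans_le hμ3) (hbd.trans_le hμ4)
    rw [← hX, ← hsS] at hpos
    refine ⟨by simpa [IsHermitian, IsSymm] using hpos.1.1, ?_, ?_, ?_, hpos⟩
    · simpa [mul_add] using hp1
    · simpa [mul_add, heq] using hp2
    · have : S.trace = 0 := by rw [hS, trace_conj_orthogonal hU, trace_planePerturbation hij]
      simpa [this] using htr
  have hfp := hfeas t (abs_of_pos ht0)
  have hfm := hfeas (-t) (by rw [abs_neg, abs_of_pos ht0])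
  have hδ : t * (B₁ * S).trace = 0 := by
    have h1 := hmax _ hfp
    have h2 := hmax _ hfm
    simp only [neg_mul] at h1 h2
    linarith
  rw [hδ, add_zero] at hfp
  rw [neg_mul, hδ, neg_zero, add_zero] at hfm
  have h := (hext _ ⟨hfp, hmax⟩ _ ⟨hfm, hmax⟩ ⟨1 / 2, 1 / 2, by norm_num, by norm_num,
    by norm_num, by ext <;> simp <;> ring⟩).1
  have hS0 : t • S = 0 := by simpa using congr_arg Prod.snd h
  have := planePerturbation_eq_zero hij
    (conj_orthogonal_eq_zero hU ((smul_eq_zero.1 hS0).resolve_left ht0.ne'))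
  tauto

lemma isClosed_setOf_posSemidef :
    IsClosed {X : Matrix (Fin n) (Fin n) ℝ | X.PosSemidef} := by
  simp only [posSemidef_iff_dotProduct_mulVec, Set.ofPred_and, Set.ofPred_forall]
  refine .inter (isClosed_eq (by fun_prop) continuous_id) (isClosed_iInter fun x => ?_)
  exact isClosed_le continuous_const (by fun_prop)

lemma abs_apply_le_one_of_posSemidef {X : Matrix (Fin n) (Fin n) ℝ} (hX : X.PosSemidef)
    (hX1 : (1 - X).PosSemidef) (i j : Fin n) : |X i j| ≤ 1 := by
  have hdiag (k : Fin n) : X k k ≤ 1 := by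
    simpa using hX1.diag_nonneg (i := k)
  have hs : X j i = X i j := by simpa using hX.1.apply i j
  have hq (s : ℝ) : 0 ≤ X i i + 2 * s * X i j + s ^ 2 * X j j := by
    have h := hX.dotProduct_mulVec_nonneg (Pi.single i 1 + s • Pi.single j 1)
    simp [mulVec_add, mulVec_smul, add_dotProduct, dotProduct_add, hs] at h
    linarith
  rw [abs_le]
  constructor
  · linarith [hq 1, hdiag i, hdiag j]
  · linarith [hq (-1), hdiag i, hdiag j]

lemma isCompact_spectraplex (d : ℕ) :
    IsCompact {X : Matrix (Fin n) (Fin n) ℝ |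
      X.IsSymm ∧ X.trace ≤ (d : ℝ) ∧ X.PosSemidef ∧ (1 - X).PosSemidef} := by
  have hc : IsCompact (Set.univ.pi fun _ : Fin n => Set.univ.pi fun _ : Fin n =>
      Set.Icc (-1 : ℝ) 1) :=
    isCompact_univ_pi fun _ => isCompact_univ_pi fun _ => isCompact_Icc
  refine IsCompact.of_isClosed_subset (X := Matrix (Fin n) (Fin n) ℝ) hc ?_ ?_
  · exact (isClosed_eq continuous_id.matrix_transpose continuous_id).inter
      ((isClosed_le continuous_id.matrix_trace continuous_const).inter
        (isClosed_setOf_posSemidef.inter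
          (isClosed_setOf_posSemidef.preimage (continuous_const.sub continuous_id))))
  · rintro X ⟨-, -, hX, hX1⟩ i - j -
    exact abs_le.1 (abs_apply_le_one_of_posSemidef hX hX1 i j)

theorem nonempty_extremePoints_fairPCAOptimal (B₁ B₂ : Matrix (Fin n) (Fin n) ℝ) (d : ℕ) :
    ((fairPCAOptimal B₁ B₂ d).extremePoints ℝ).Nonempty := by
  set K := {X : Matrix (Fin n) (Fin n) ℝ |
      X.IsSymm ∧ X.trace ≤ (d : ℝ) ∧ X.PosSemidef ∧ (1 - X).PosSemidef} with hK
  have hKc : IsCompact K := isCompact_spectraplex d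
  have hcont (B : Matrix (Fin n) (Fin n) ℝ) :
      Continuous fun X : Matrix (Fin n) (Fin n) ℝ => (B * X).trace := by fun_prop
  obtain ⟨X₀, ⟨hX₀s, hX₀t, hX₀p, hX₀q⟩, hX₀⟩ := hKc.exists_isMaxOn
    ⟨0, by simp [hK, PosSemidef.zero, PosSemidef.one]⟩
    ((hcont B₁).min (hcont B₂)).continuousOn
  set z := min (B₁ * X₀).trace (B₂ * X₀).trace with hz
  have hle : ∀ q ∈ fairPCAFeasible B₁ B₂ d, q.1 ≤ z := fun q ⟨h1, h2, h3, h4, h5, h6⟩ =>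
    (le_min h2 h3).trans (hX₀ ⟨h1, h4, h5, h6⟩)
  have hfeas : (z, X₀) ∈ fairPCAFeasible B₁ B₂ d :=
    ⟨hX₀s, min_le_left _ _, min_le_right _ _, hX₀t, hX₀p, hX₀q⟩
  have hOpt : fairPCAOptimal B₁ B₂ d =
      {z} ×ˢ (K ∩ {X | z ≤ (B₁ * X).trace} ∩ {X | z ≤ (B₂ * X).trace}) := by
    ext ⟨y, X⟩
    constructor
    · rintro ⟨hy, hmax⟩
      obtain rfl : y = z := (hle _ hy).antisymm (hmax _ hfeas)
      obtain ⟨h1, h2, h3, h4, h5, h6⟩ := hy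
      exact ⟨rfl, ⟨⟨h1, h4, h5, h6⟩, h2⟩, h3⟩
    · rintro ⟨rfl, ⟨⟨h1, h4, h5, h6⟩, h2⟩, h3⟩
      exact ⟨⟨h1, h2, h3, h4, h5, h6⟩, hle⟩
  have hlc : LocallyConvexSpace ℝ (Matrix (Fin n) (Fin n) ℝ) :=
    inferInstanceAs (LocallyConvexSpace ℝ (Fin n → Fin n → ℝ))
  refine IsCompact.extremePoints_nonempty ?_ ⟨_, hfeas, hle⟩
  rw [hOpt]
  exact isCompact_singleton.prod ((hKc.inter_right
    (isClosed_le continuous_const (hcont B₁))).inter_right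
    (isClosed_le continuous_const (hcont B₂)))

/-- A matrix `0 ⪯ X ⪯ 1` of rank at most `d` is dominated, for every Gram objective, by a projection
of rank `d`. -/
lemma exists_orthonormal_trace_le (hdn : d ≤ n) {X : Matrix (Fin n) (Fin n) ℝ}
    (hX : X.PosSemidef) (hX1 : (1 - X).PosSemidef) (hr : X.rank ≤ d) :
    ∃ P : Matrix (Fin n) (Fin d) ℝ, Pᵀ * P = 1 ∧
      ∀ (m : ℕ) (A : Matrix (Fin m) (Fin n) ℝ),
        (Aᵀ * A * X).trace ≤ ((A * P)ᵀ * (A * P)).trace := by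
  obtain ⟨U, w, hU, -, hXU, -, hw1, -, hrank⟩ := exists_orthogonal_diagonalization_s2 hX hX1
  obtain ⟨T, hNT, hT⟩ := Finset.exists_superset_card_eq (hrank ▸ hr) (by simpa using hdn)
  let e := T.orderEmbOfFin hT
  have hcols {m : ℕ} (A : Matrix (Fin m) (Fin n) ℝ) :
      (A * U.submatrix id e)ᵀ * (A * U.submatrix id e) = ((A * U)ᵀ * (A * U)).submatrix e e := rfl
  refine ⟨U.submatrix id e, ?_, fun m A => ?_⟩
  · have h : (U.submatrix id e)ᵀ * U.submatrix id e = (Uᵀ * U).submatrix e e := rfl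
    rw [h, hU, submatrix_one _ e.injective]
  · set M := (A * U)ᵀ * (A * U) with hM
    have hM0 (l : Fin n) : 0 ≤ M l l :=
      (posSemidef_conjTranspose_mul_self (A * U)).diag_nonneg (i := l)
    have hl : (Aᵀ * A * X).trace = ∑ l, M l l * w l := by
      rw [hXU, ← Matrix.mul_assoc, trace_mul_comm, ← Matrix.mul_assoc, ← Matrix.mul_assoc,
        show Uᵀ * (Aᵀ * A) * U = M by simp only [hM, transpose_mul, Matrix.mul_assoc]]
      simp [trace, mul_diagonal]
    have hr' : (M.submatrix e e).trace = ∑ l ∈ T, M l l := by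
      rw [← Finset.map_orderEmbOfFin_univ T hT, Finset.sum_map]
      rfl
    rw [hcols A, hr', hl]
    calc ∑ l, M l l * w l = ∑ l ∈ T, M l l * w l := by
          refine (Finset.sum_subset T.subset_univ fun l _ hlT => ?_).symm
          have : w l = 0 := by
            by_contra h
            exact hlT (hNT (by simpa using h))
          rw [this, mul_zero]
      _ ≤ ∑ l ∈ T, M l l := Finset.sum_le_sum fun l _ => mul_le_of_le_one_right (hM0 l) (hw1 l)

lemma mem_fairPCAFeasible_of_orthonormal {m₁ m₂ : ℕ} (A₁ : Matrix (Fin m₁) (Fin n) ℝ)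
    (A₂ : Matrix (Fin m₂) (Fin n) ℝ) {P : Matrix (Fin n) (Fin d) ℝ} (hP : Pᵀ * P = 1) :
    (min (((A₁ * P)ᵀ * (A₁ * P)).trace) (((A₂ * P)ᵀ * (A₂ * P)).trace), P * Pᵀ) ∈
      fairPCAFeasible (A₁ᵀ * A₁) (A₂ᵀ * A₂) d := by
  have htr {m : ℕ} (A : Matrix (Fin m) (Fin n) ℝ) :
      ((A * P)ᵀ * (A * P)).trace = (Aᵀ * A * (P * Pᵀ)).trace := by
    rw [← Matrix.mul_assoc (Aᵀ * A), trace_mul_comm _ Pᵀ]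
    simp only [transpose_mul, Matrix.mul_assoc]
  refine ⟨by simp [IsSymm], (min_le_left _ _).trans_eq (htr A₁),
    (min_le_right _ _).trans_eq (htr A₂), ?_, ?_, ?_⟩
  · simp [trace_mul_comm P, hP]
  · simpa using posSemidef_self_mul_conjTranspose P
  · have h := posSemidef_conjTranspose_mul_self (1 - P * Pᵀ)
    have e : (1 - P * Pᵀ)ᴴ * (1 - P * Pᵀ) = 1 - P * Pᵀ := by
      have hi : P * Pᵀ * (P * Pᵀ) = P * Pᵀ := by
        rw [Matrix.mul_assoc, ← Matrix.mul_assoc Pᵀ, hP, Matrix.one_mul]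
      simp [mul_sub, sub_mul, hi]
    rwa [e] at h

end Relaxation

/-- For two groups, every extreme point of the set of optimal
solutions of the Fair-PCA SDP relaxation has rank at most `d`, and the optimal
value of the relaxation equals the optimum of exact Fair-PCA. -/
theorem stmt2 {m₁ m₂ n d : ℕ} (hd : 0 < d) (hdn : d ≤ n)
    (A₁ : Matrix (Fin m₁) (Fin n) ℝ) (A₂ : Matrix (Fin m₂) (Fin n) ℝ)
    (Feas : Set (ℝ × Matrix (Fin n) (Fin n) ℝ))
    (hFeas : Feas = {p | p.2.IsSymm ∧
      p.1 ≤ ((A₁ᵀ * A₁)ᵀ * p.2).trace ∧ p.1 ≤ ((A₂ᵀ * A₂)ᵀ * p.2).trace ∧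
      p.2.trace ≤ (d : ℝ) ∧ p.2.PosSemidef ∧
      ((1 : Matrix (Fin n) (Fin n) ℝ) - p.2).PosSemidef})
    (Opt : Set (ℝ × Matrix (Fin n) (Fin n) ℝ))
    (hOpt : Opt = {p ∈ Feas | ∀ q ∈ Feas, q.1 ≤ p.1}) :
    (∀ p ∈ Opt.extremePoints ℝ, p.2.rank ≤ d) ∧
    sSup (Prod.fst '' Feas) =
      sSup {v : ℝ | ∃ P : Matrix (Fin n) (Fin d) ℝ, Pᵀ * P = 1 ∧
        v = min (((A₁ * P)ᵀ * (A₁ * P)).trace) (((A₂ * P)ᵀ * (A₂ * P)).trace)} := by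
  have hF : Feas = fairPCAFeasible (A₁ᵀ * A₁) (A₂ᵀ * A₂) d := by
    simp [hFeas, fairPCAFeasible]
  have hO : Opt = fairPCAOptimal (A₁ᵀ * A₁) (A₂ᵀ * A₂) d := by
    rw [hOpt, hF, fairPCAOptimal]
  rw [hO, hF]
  refine ⟨fun p hp => rank_le_of_mem_extremePoints_fairPCAOptimal hp, ?_⟩
  obtain ⟨p, hp⟩ := nonempty_extremePoints_fairPCAOptimal (A₁ᵀ * A₁) (A₂ᵀ * A₂) d
  have hrank := rank_le_of_mem_extremePoints_fairPCAOptimal hp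
  obtain ⟨hfeas, hmax⟩ := hp.1
  obtain ⟨-, hp1, hp2, -, hpsd, hpsd1⟩ := hfeas
  obtain ⟨P, hP, hle⟩ := exists_orthonormal_trace_le hdn hpsd hpsd1 hrank
  have hval : p.1 = min (((A₁ * P)ᵀ * (A₁ * P)).trace) (((A₂ * P)ᵀ * (A₂ * P)).trace) :=
    (le_min (hp1.trans (hle _ A₁)) (hp2.trans (hle _ A₂))).antisymm
      (hmax _ (mem_fairPCAFeasible_of_orthonormal A₁ A₂ hP))
  have hsdp : IsGreatest (Prod.fst '' fairPCAFeasible (A₁ᵀ * A₁) (A₂ᵀ * A₂) d) p.1 :=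
    ⟨⟨p, hp.1.1, rfl⟩, by rintro _ ⟨q, hq, rfl⟩; exact hmax q hq⟩
  have hexact : IsGreatest {v : ℝ | ∃ P : Matrix (Fin n) (Fin d) ℝ, Pᵀ * P = 1 ∧
      v = min (((A₁ * P)ᵀ * (A₁ * P)).trace) (((A₂ * P)ᵀ * (A₂ * P)).trace)} p.1 :=
    ⟨⟨P, hP, hval⟩, by
      rintro _ ⟨Q, hQ, rfl⟩
      exact hmax _ (mem_fairPCAFeasible_of_orthonormal A₁ A₂ hQ)⟩
  rw [hsdp.csSup_eq, hexact.csSup_eq]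
end

section
/- Let A_1 ∈ ℝ^{m_1×n} and A_2 ∈ ℝ^{m_2×n} be data matrices of two groups and let d ≤ n be a positive integer. For i = 1, 2 let β_i := max over Q ∈ P_d of ‖A_iQ‖_F². Let P* ∈ P_d be a minimizer of the marginal loss objective max{β_1 − ‖A_1P‖_F², β_2 − ‖A_2P‖_F²} over P ∈ P_d. Then β_1 − ‖A_1P*‖_F² = β_2 − ‖A_2P*‖_F², i.e., at any optimal solution the two groups incur equal marginal losses. -/
open Matrix

section TraceQuadraticForm

variable {m n d : Type*} [Fintype m] [Fintype n] [Fintype d]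

lemma trace_transpose_mul_mul_add_vecMulVec {S : Matrix n n ℝ} (hS : Sᵀ = S)
    (P : Matrix n d ℝ) (w : n → ℝ) (x : d → ℝ) :
    ((P + vecMulVec w x)ᵀ * S * (P + vecMulVec w x)).trace =
      (Pᵀ * S * P).trace + 2 * (w ⬝ᵥ S *ᵥ (P *ᵥ x)) + (x ⬝ᵥ x) * (w ⬝ᵥ S *ᵥ w) := by
  have h₁ : (Pᵀ * S * vecMulVec w x).trace = w ⬝ᵥ S *ᵥ (P *ᵥ x) := by
    rw [mul_vecMulVec, trace_vecMulVec, ← mulVec_mulVec, dotProduct_comm, dotProduct_mulVec,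
      vecMul_transpose, dotProduct_mulVec, ← mulVec_transpose, hS, dotProduct_comm]
  have h₂ : ((vecMulVec w x)ᵀ * S * P).trace = w ⬝ᵥ S *ᵥ (P *ᵥ x) := by
    rw [← h₁, ← trace_transpose]
    simp [transpose_mul, hS, Matrix.mul_assoc]
  have h₃ : ((vecMulVec w x)ᵀ * S * vecMulVec w x).trace = (x ⬝ᵥ x) * (w ⬝ᵥ S *ᵥ w) := by
    rw [transpose_vecMulVec, vecMulVec_mul, vecMulVec_mul_vecMulVec, trace_vecMulVec,
      dotProduct_smul, smul_eq_mul, ← dotProduct_mulVec, mul_comm]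
  rw [transpose_add, Matrix.add_mul, Matrix.add_mul, Matrix.mul_add, Matrix.mul_add]
  simp only [trace_add, h₁, h₂, h₃]
  ring

lemma exists_pos_sq_mul_dotProduct_self_eq_one {v : n → ℝ} (hv : v ≠ 0) :
    ∃ c : ℝ, 0 < c ∧ c ^ 2 * (v ⬝ᵥ v) = 1 := by
  have hpos : 0 < v ⬝ᵥ v := by simpa using dotProduct_star_self_pos_iff.2 hv
  refine ⟨(√(v ⬝ᵥ v))⁻¹, by positivity, ?_⟩
  rw [inv_pow, Real.sq_sqrt hpos.le, inv_mul_cancel₀ hpos.ne']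

lemma trace_transpose_mul_mul (S : Matrix n n ℝ) (R : Matrix n d ℝ) :
    (Rᵀ * S * R).trace = ∑ j, Rᵀ j ⬝ᵥ S *ᵥ Rᵀ j := by
  simp only [trace, diag_apply, Matrix.mul_assoc]
  rfl

variable [DecidableEq d]

/-- Rotating the column combination `P *ᵥ x` towards the orthogonal direction `q`. -/
lemma transpose_mul_self_add_vecMulVec_rotation {P : Matrix n d ℝ} (hP : Pᵀ * P = 1)
    {x : d → ℝ} {q : n → ℝ} (hx : x ⬝ᵥ x = 1) (hq : q ⬝ᵥ q = 1) (hPq : Pᵀ *ᵥ q = 0) (t : ℝ) :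
    (P + vecMulVec ((Real.cos t - 1) • P *ᵥ x + Real.sin t • q) x)ᵀ *
      (P + vecMulVec ((Real.cos t - 1) • P *ᵥ x + Real.sin t • q) x) = 1 := by
  set w := (Real.cos t - 1) • P *ᵥ x + Real.sin t • q with hw
  have hPw : Pᵀ *ᵥ w = (Real.cos t - 1) • x := by
    rw [hw, mulVec_add, mulVec_smul, mulVec_smul, hPq, mulVec_mulVec, hP]
    simp
  have hqP : q ⬝ᵥ P *ᵥ x = 0 := by
    rw [dotProduct_mulVec, ← mulVec_transpose, hPq, zero_dotProduct]
  have hPP : (P *ᵥ x) ⬝ᵥ (P *ᵥ x) = 1 := by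
    rw [dotProduct_mulVec, ← mulVec_transpose, mulVec_mulVec, hP, one_mulVec, hx]
  have hww : w ⬝ᵥ w = 2 - 2 * Real.cos t := by
    simp only [hw, add_dotProduct, dotProduct_add, smul_dotProduct, dotProduct_smul, smul_eq_mul,
      hqP, hPP, hq, dotProduct_comm (P *ᵥ x) q]
    linear_combination Real.sin_sq_add_cos_sq t
  have hwP : w ᵥ* P = (Real.cos t - 1) • x := by rw [← hPw, mulVec_transpose]
  rw [transpose_add, Matrix.add_mul, Matrix.mul_add, Matrix.mul_add, hP, transpose_vecMulVec,
    mul_vecMulVec, hPw, vecMulVec_mul, hwP, vecMulVec_mul_vecMulVec, hww]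
  ext i j
  simp only [Matrix.add_apply, vecMulVec_apply, Pi.smul_apply, smul_eq_mul]
  ring

lemma isLocalMaxOn_trace_first_second_order {S : Matrix n n ℝ} (hS : Sᵀ = S)
    {P : Matrix n d ℝ} (hP : Pᵀ * P = 1)
    (h : IsLocalMaxOn (fun Q : Matrix n d ℝ => (Qᵀ * S * Q).trace) {Q | Qᵀ * Q = 1} P)
    {x : d → ℝ} {q : n → ℝ} (hx : x ⬝ᵥ x = 1) (hq : q ⬝ᵥ q = 1) (hPq : Pᵀ *ᵥ q = 0) :
    q ⬝ᵥ S *ᵥ (P *ᵥ x) = 0 ∧ q ⬝ᵥ S *ᵥ q ≤ (P *ᵥ x) ⬝ᵥ S *ᵥ (P *ᵥ x) := by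
  set p := P *ᵥ x with hp
  set a := p ⬝ᵥ S *ᵥ p with ha
  set b := q ⬝ᵥ S *ᵥ q with hb
  set e := q ⬝ᵥ S *ᵥ p with he
  have he' : p ⬝ᵥ S *ᵥ q = e := by
    rw [dotProduct_mulVec, ← mulVec_transpose, hS, dotProduct_comm]
  let γ : ℝ → Matrix n d ℝ := fun t => P + vecMulVec ((Real.cos t - 1) • p + Real.sin t • q) x
  have hγ0 : γ 0 = P := by simp [γ]
  have hγc : Continuous γ := by
    refine continuous_matrix fun i j => ?_
    simp only [γ, Matrix.add_apply, vecMulVec_apply, Pi.add_apply, Pi.smul_apply, smul_eq_mul]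
    fun_prop
  have hval : ∀ t, ((γ t)ᵀ * S * γ t).trace = (Pᵀ * S * P).trace +
      (Real.sin t ^ 2 * (b - a) + 2 * Real.cos t * Real.sin t * e) := by
    intro t
    simp only [γ, trace_transpose_mul_mul_add_vecMulVec hS, hx, ← hp, add_dotProduct,
      dotProduct_add, smul_dotProduct, dotProduct_smul, smul_eq_mul, mulVec_add, mulVec_smul,
      ← ha, ← hb, ← he, he']
    linear_combination a * Real.sin_sq_add_cos_sq t
  have hev : ∀ᶠ t in nhds (0 : ℝ),
      Real.sin t ^ 2 * (b - a) + 2 * Real.cos t * Real.sin t * e ≤ 0 := by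
    have hlim : Filter.Tendsto γ (nhds 0) (nhdsWithin P {Q | Qᵀ * Q = 1}) := by
      refine tendsto_nhdsWithin_iff.2 ⟨?_, Filter.Eventually.of_forall fun t =>
        transpose_mul_self_add_vecMulVec_rotation hP hx hq hPq t⟩
      simpa [hγ0] using hγc.tendsto 0
    filter_upwards [hlim.eventually h] with t ht
    rw [hval] at ht
    linarith
  have he0 : e = 0 := by
    have hmax : IsLocalMax
        (fun t => Real.sin t ^ 2 * (b - a) + 2 * Real.cos t * Real.sin t * e) 0 := by
      filter_upwards [hev] with t ht
      simpa using ht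
    have hder := (((Real.hasDerivAt_sin 0).pow 2).mul_const (b - a)).add
      ((((Real.hasDerivAt_cos 0).const_mul 2).mul (Real.hasDerivAt_sin 0)).mul_const e)
    simpa using hmax.hasDerivAt_eq_zero hder
  refine ⟨he0, ?_⟩
  obtain ⟨t, ⟨ht, htpi⟩, ht0⟩ := (((hev.and (Iio_mem_nhds Real.pi_pos)).filter_mono
    nhdsWithin_le_nhds).and (self_mem_nhdsWithin (s := Set.Ioi (0 : ℝ)))).exists
  have hsin : 0 < Real.sin t ^ 2 := pow_pos (Real.sin_pos_of_pos_of_lt_pi ht0 htpi) 2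
  rw [he0, mul_zero, add_zero] at ht
  nlinarith

lemma isLocalMaxOn_trace_homogeneous {S : Matrix n n ℝ} (hS : Sᵀ = S)
    {P : Matrix n d ℝ} (hP : Pᵀ * P = 1)
    (h : IsLocalMaxOn (fun Q : Matrix n d ℝ => (Qᵀ * S * Q).trace) {Q | Qᵀ * Q = 1} P)
    (x : d → ℝ) {q : n → ℝ} (hPq : Pᵀ *ᵥ q = 0) :
    q ⬝ᵥ S *ᵥ (P *ᵥ x) = 0 ∧
      (x ⬝ᵥ x) * (q ⬝ᵥ S *ᵥ q) ≤ (q ⬝ᵥ q) * ((P *ᵥ x) ⬝ᵥ S *ᵥ (P *ᵥ x)) := by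
  rcases eq_or_ne x 0 with rfl | hx
  · simp
  rcases eq_or_ne q 0 with rfl | hq
  · simp
  obtain ⟨c, hc, hcx⟩ := exists_pos_sq_mul_dotProduct_self_eq_one hx
  obtain ⟨k, hk, hkq⟩ := exists_pos_sq_mul_dotProduct_self_eq_one hq
  obtain ⟨h₁, h₂⟩ := isLocalMaxOn_trace_first_second_order hS hP h (x := c • x) (q := k • q)
    (by simp only [smul_dotProduct, dotProduct_smul, smul_eq_mul]; linarith)
    (by simp only [smul_dotProduct, dotProduct_smul, smul_eq_mul]; linarith)
    (by rw [mulVec_smul, hPq, smul_zero])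
  simp only [mulVec_smul, smul_dotProduct, dotProduct_smul, smul_eq_mul] at h₁ h₂
  refine ⟨by simpa [hc.ne', hk.ne'] using h₁, ?_⟩
  have hxx : x ⬝ᵥ x = (c ^ 2)⁻¹ := eq_inv_of_mul_eq_one_right hcx
  have hqq : q ⬝ᵥ q = (k ^ 2)⁻¹ := eq_inv_of_mul_eq_one_right hkq
  rw [hxx, hqq, inv_mul_eq_div, inv_mul_eq_div, div_le_div_iff₀ (by positivity) (by positivity)]
  linarith

/-- Every local maximizer of the variance over matrices with orthonormal columns is global. -/
theorem IsLocalMaxOn.isMaxOn_trace_transpose_mul_mul {S : Matrix n n ℝ}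
    (hS : Sᵀ = S) {P : Matrix n d ℝ} (hP : Pᵀ * P = 1)
    (h : IsLocalMaxOn (fun Q : Matrix n d ℝ => (Qᵀ * S * Q).trace) {Q | Qᵀ * Q = 1} P) :
    IsMaxOn (fun Q : Matrix n d ℝ => (Qᵀ * S * Q).trace) {Q | Qᵀ * Q = 1} P := by
  intro Q (hQ : Qᵀ * Q = 1)
  change (Qᵀ * S * Q).trace ≤ (Pᵀ * S * P).trace
  set A := Pᵀ * Q with hA
  set R := Q - P * A with hR
  set B := P - Q * Aᵀ with hB
  have hAt : Aᵀ = Qᵀ * P := by simp [hA]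
  have hPR : Pᵀ * R = 0 := by
    rw [hR, Matrix.mul_sub, ← Matrix.mul_assoc, hP, Matrix.one_mul, sub_self]
  have hcol (j : d) : Pᵀ *ᵥ Rᵀ j = 0 := by
    ext i
    exact congrFun (congrFun hPR i) j
  have hRSP : Rᵀ * S * P = 0 := by
    ext j k
    have := (isLocalMaxOn_trace_homogeneous hS hP h (Pi.single k 1) (hcol j)).1
    rw [mulVec_single_one] at this
    rw [Matrix.mul_assoc]
    exact this
  have hPSR : Pᵀ * S * R = 0 := by
    rw [← transpose_inj]
    simpa [hS, Matrix.mul_assoc] using hRSP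
  have hRR : Rᵀ * R = 1 - Aᵀ * A := by
    nth_rw 1 [hR]
    rw [transpose_sub, Matrix.sub_mul, transpose_mul, Matrix.mul_assoc Aᵀ, hPR, hR, Matrix.mul_sub,
      hQ, ← Matrix.mul_assoc, ← hAt]
    simp
  have hBB : Bᵀ * B = 1 - A * Aᵀ := by
    have hQB : Qᵀ * B = 0 := by
      rw [hB, Matrix.mul_sub, ← Matrix.mul_assoc, hQ, Matrix.one_mul, hAt, sub_self]
    nth_rw 1 [hB]
    rw [transpose_sub, Matrix.sub_mul, transpose_mul, Matrix.mul_assoc _ Qᵀ, hQB, hB,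
      Matrix.mul_sub, hP, ← Matrix.mul_assoc, ← hA]
    simp
  have htr : (Rᵀ * R).trace = (B * Bᵀ).trace := by
    rw [trace_mul_comm B, hRR, hBB, trace_sub, trace_sub, trace_mul_comm A]
  have hfQ : (Qᵀ * S * Q).trace = (Rᵀ * S * R).trace + (Aᵀ * (Pᵀ * S * P) * A).trace := by
    have hQRA : Q = R + P * A := by rw [hR, sub_add_cancel]
    rw [hQRA, transpose_add, Matrix.add_mul, Matrix.add_mul, Matrix.mul_add, Matrix.mul_add,
      ← Matrix.mul_assoc (Rᵀ * S), hRSP, transpose_mul, Matrix.mul_assoc Aᵀ, Matrix.mul_assoc Aᵀ,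
      hPSR, Matrix.zero_mul, Matrix.mul_zero, add_zero, zero_add, trace_add]
    simp only [Matrix.mul_assoc]
  have hfP : (Pᵀ * S * P).trace - (Aᵀ * (Pᵀ * S * P) * A).trace =
      (B * (Pᵀ * S * P) * Bᵀ).trace := by
    rw [trace_mul_cycle B, hBB, Matrix.sub_mul, Matrix.one_mul, trace_sub, trace_mul_cycle Aᵀ]
  have hkey : (B * Bᵀ).trace * (Rᵀ * S * R).trace ≤
      (Rᵀ * R).trace * (B * (Pᵀ * S * P) * Bᵀ).trace := by
    have e₁ : (B * Bᵀ).trace = ∑ i, B i ⬝ᵥ B i := rfl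
    have e₂ : (Rᵀ * R).trace = ∑ j, Rᵀ j ⬝ᵥ Rᵀ j := rfl
    have e₃ : (B * (Pᵀ * S * P) * Bᵀ).trace = ∑ i, (P *ᵥ B i) ⬝ᵥ S *ᵥ (P *ᵥ B i) := by
      have := trace_transpose_mul_mul S (P * Bᵀ)
      rw [transpose_mul, transpose_transpose] at this
      have hrow (i : n) : (B * Pᵀ) i = P *ᵥ B i := by
        rw [mul_apply_eq_vecMul, vecMul_transpose]
      simpa only [Matrix.mul_assoc, hrow] using this
    rw [e₁, e₂, e₃, trace_transpose_mul_mul, Finset.sum_mul_sum, Finset.sum_mul_sum,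
      Finset.sum_comm]
    exact Finset.sum_le_sum fun j _ => Finset.sum_le_sum fun i _ =>
      (isLocalMaxOn_trace_homogeneous hS hP h (B i) (hcol j)).2
  suffices (Rᵀ * S * R).trace ≤ (B * (Pᵀ * S * P) * Bᵀ).trace by linarith
  have hnonneg : 0 ≤ (B * Bᵀ).trace :=
    Finset.sum_nonneg fun i _ => Finset.sum_nonneg fun j _ => mul_self_nonneg (B i j)
  rcases hnonneg.eq_or_lt with h0 | hpos
  · have hR0 : R = 0 := by
      rw [← trace_conjTranspose_mul_self_eq_zero_iff, conjTranspose_eq_transpose_of_trivial, htr,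
        ← h0]
    have hB0 : B = 0 := by
      rw [← trace_mul_conjTranspose_self_eq_zero_iff, conjTranspose_eq_transpose_of_trivial, ← h0]
    simp [hR0, hB0]
  · rw [htr] at hkey
    exact le_of_mul_le_mul_left hkey hpos

/-- A minimizer of the larger of two marginal losses cannot leave the first group with the
strictly larger loss. -/
lemma marginal_loss_le_of_isMinOn_max {m' : Type*} [Fintype m']
    (A₁ : Matrix m n ℝ) (A₂ : Matrix m' n ℝ) {β₁ β₂ : ℝ}
    (hβ₁ : ∃ Q : Matrix n d ℝ, Qᵀ * Q = 1 ∧ β₁ = ((A₁ * Q)ᵀ * (A₁ * Q)).trace)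
    {P : Matrix n d ℝ} (hP : Pᵀ * P = 1) (hβ₂ : ((A₂ * P)ᵀ * (A₂ * P)).trace ≤ β₂)
    (hopt : ∀ Q : Matrix n d ℝ, Qᵀ * Q = 1 →
      max (β₁ - ((A₁ * P)ᵀ * (A₁ * P)).trace) (β₂ - ((A₂ * P)ᵀ * (A₂ * P)).trace) ≤
      max (β₁ - ((A₁ * Q)ᵀ * (A₁ * Q)).trace) (β₂ - ((A₂ * Q)ᵀ * (A₂ * Q)).trace)) :
    β₁ - ((A₁ * P)ᵀ * (A₁ * P)).trace ≤ β₂ - ((A₂ * P)ᵀ * (A₂ * P)).trace := by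
  by_contra! hlt
  have hcont : Continuous fun Q : Matrix n d ℝ => ((A₂ * Q)ᵀ * (A₂ * Q)).trace := by
    fun_prop
  have hform (Q : Matrix n d ℝ) :
      (Qᵀ * (A₁ᵀ * A₁) * Q).trace = ((A₁ * Q)ᵀ * (A₁ * Q)).trace := by
    simp only [transpose_mul, Matrix.mul_assoc]
  have hloc : IsLocalMaxOn (fun Q : Matrix n d ℝ => (Qᵀ * (A₁ᵀ * A₁) * Q).trace)
      {Q | Qᵀ * Q = 1} P := by
    have hev : ∀ᶠ Q in nhds P, β₂ - ((A₂ * Q)ᵀ * (A₂ * Q)).trace <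
        β₁ - ((A₁ * P)ᵀ * (A₁ * P)).trace :=
      (continuous_const.sub hcont).continuousAt.eventually_lt continuousAt_const hlt
    filter_upwards [hev.filter_mono nhdsWithin_le_nhds, self_mem_nhdsWithin] with Q hQ hQ1
    rw [hform, hform]
    rcases le_max_iff.1 ((le_max_left _ _).trans (hopt Q hQ1)) with hle | hle <;> linarith
  obtain ⟨Q, hQ, rfl⟩ := hβ₁
  have hle := hloc.isMaxOn_trace_transpose_mul_mul (by simp) hP hQ
  simp only [Set.mem_ofPred_eq, hform] at hle
  linarith

end TraceQuadraticForm

/-- At any optimal solution of the two-group marginal loss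
objective, the two groups incur equal marginal losses. -/
theorem stmt8 {m₁ m₂ n d : ℕ} (hd : 0 < d) (hdn : d ≤ n)
    (A₁ : Matrix (Fin m₁) (Fin n) ℝ) (A₂ : Matrix (Fin m₂) (Fin n) ℝ)
    (β₁ β₂ : ℝ)
    (hβ₁ : IsGreatest {v : ℝ | ∃ Q : Matrix (Fin n) (Fin d) ℝ, Qᵀ * Q = 1 ∧
      v = ((A₁ * Q)ᵀ * (A₁ * Q)).trace} β₁)
    (hβ₂ : IsGreatest {v : ℝ | ∃ Q : Matrix (Fin n) (Fin d) ℝ, Qᵀ * Q = 1 ∧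
      v = ((A₂ * Q)ᵀ * (A₂ * Q)).trace} β₂)
    (P : Matrix (Fin n) (Fin d) ℝ) (hP : Pᵀ * P = 1)
    (hopt : ∀ Q : Matrix (Fin n) (Fin d) ℝ, Qᵀ * Q = 1 →
      max (β₁ - ((A₁ * P)ᵀ * (A₁ * P)).trace) (β₂ - ((A₂ * P)ᵀ * (A₂ * P)).trace) ≤
      max (β₁ - ((A₁ * Q)ᵀ * (A₁ * Q)).trace) (β₂ - ((A₂ * Q)ᵀ * (A₂ * Q)).trace)) :
    β₁ - ((A₁ * P)ᵀ * (A₁ * P)).trace = β₂ - ((A₂ * P)ᵀ * (A₂ * P)).trace := by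
  refine le_antisymm
    (marginal_loss_le_of_isMinOn_max A₁ A₂ hβ₁.1 hP (hβ₂.2 ⟨P, hP, rfl⟩) hopt)
    (marginal_loss_le_of_isMinOn_max A₂ A₁ hβ₂.1 hP (hβ₁.2 ⟨P, hP, rfl⟩) fun Q hQ => ?_)
  simpa only [max_comm] using hopt Q hQ
end

section
/- Let A ∈ ℝ^{a×n} be a real matrix and let d ≤ n be a positive integer. Suppose P* ∈ P_d is a local maximum of the function P ↦ ‖AP‖_F² on P_d, meaning there exists ε > 0 such that ‖AP‖_F² ≤ ‖AP*‖_F² for every P ∈ P_d with ‖P − P*‖_F < ε. Then ‖AP*‖_F² equals the global maximum of ‖AP‖_F² over P ∈ P_d, which is the sum λ_1 + … + λ_d of the d largest eigenvalues of AᵀA. In particular, the value of this function at any local maximum is the same. -/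
open Matrix

/-- The `i`-th largest eigenvalue (0-indexed) of a Hermitian real matrix. -/
noncomputable def eigsDesc {N : ℕ} {M : Matrix (Fin N) (Fin N) ℝ}
    (hM : M.IsHermitian) : Fin N → ℝ :=
  fun i => hM.eigenvalues (Tuple.sort hM.eigenvalues i.rev)

section RankOne

variable {n d : ℕ}

lemma trace_quadratic_add_vecMulVec {M : Matrix (Fin n) (Fin n) ℝ} (hM : Mᵀ = M)
    (P : Matrix (Fin n) (Fin d) ℝ) (u : Fin n → ℝ) (x : Fin d → ℝ) :
    ((P + vecMulVec u x)ᵀ * M * (P + vecMulVec u x)).trace =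
      (Pᵀ * M * P).trace + 2 * (u ⬝ᵥ M *ᵥ (P *ᵥ x)) + (x ⬝ᵥ x) * (u ⬝ᵥ M *ᵥ u) := by
  have h₁ : ((vecMulVec u x)ᵀ * M * P).trace = u ⬝ᵥ M *ᵥ (P *ᵥ x) := by
    rw [transpose_vecMulVec, Matrix.mul_assoc, vecMulVec_mul, trace_vecMulVec, dotProduct_comm,
      ← dotProduct_mulVec, mulVec_mulVec]
  have h₂ : (Pᵀ * M * vecMulVec u x).trace = u ⬝ᵥ M *ᵥ (P *ᵥ x) := by
    rw [← h₁, ← trace_transpose]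
    simp only [transpose_mul, transpose_transpose, hM, Matrix.mul_assoc]
  have h₃ : ((vecMulVec u x)ᵀ * M * vecMulVec u x).trace = (x ⬝ᵥ x) * (u ⬝ᵥ M *ᵥ u) := by
    rw [transpose_vecMulVec, Matrix.mul_assoc, mul_vecMulVec, vecMulVec_mul_vecMulVec,
      trace_vecMulVec, dotProduct_smul, smul_eq_mul, mul_comm]
  rw [transpose_add, Matrix.add_mul, Matrix.mul_add, Matrix.add_mul, Matrix.add_mul, trace_add,
    trace_add, trace_add, h₁, h₂, h₃]
  ring

lemma dotProduct_mulVec_orthonormal {P : Matrix (Fin n) (Fin d) ℝ} (hP : Pᵀ * P = 1)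
    (x y : Fin d → ℝ) : (P *ᵥ x) ⬝ᵥ (P *ᵥ y) = x ⬝ᵥ y := by
  rw [dotProduct_mulVec, vecMul_mulVec, hP, vecMul_one]

lemma rotation_dotProduct_self {P : Matrix (Fin n) (Fin d) ℝ} (hP : Pᵀ * P = 1)
    {x : Fin d → ℝ} (hx : x ⬝ᵥ x = 1) {w : Fin n → ℝ} (hw : w ⬝ᵥ w = 1) (hPw : Pᵀ *ᵥ w = 0)
    {c s : ℝ} (hcs : c ^ 2 + s ^ 2 = 1) :
    ((c - 1) • P *ᵥ x + s • w) ⬝ᵥ ((c - 1) • P *ᵥ x + s • w) = 2 - 2 * c := by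
  have h₁ : w ⬝ᵥ (P *ᵥ x) = 0 := by
    rw [dotProduct_mulVec, ← mulVec_transpose, hPw, zero_dotProduct]
  have h₂ : (P *ᵥ x) ⬝ᵥ w = 0 := by rw [dotProduct_comm, h₁]
  simp only [add_dotProduct, dotProduct_add, smul_dotProduct, dotProduct_smul, smul_eq_mul,
    dotProduct_mulVec_orthonormal hP, hx, h₁, h₂, hw]
  linear_combination hcs

lemma add_vecMulVec_orthonormal {P : Matrix (Fin n) (Fin d) ℝ} (hP : Pᵀ * P = 1)
    {x : Fin d → ℝ} (hx : x ⬝ᵥ x = 1) {w : Fin n → ℝ} (hw : w ⬝ᵥ w = 1) (hPw : Pᵀ *ᵥ w = 0)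
    {c s : ℝ} (hcs : c ^ 2 + s ^ 2 = 1) :
    (P + vecMulVec ((c - 1) • P *ᵥ x + s • w) x)ᵀ *
      (P + vecMulVec ((c - 1) • P *ᵥ x + s • w) x) = 1 := by
  have hPu : Pᵀ *ᵥ ((c - 1) • P *ᵥ x + s • w) = (c - 1) • x := by
    rw [mulVec_add, mulVec_smul, mulVec_smul, hPw, mulVec_mulVec, hP]; simp
  have huu := rotation_dotProduct_self hP hx hw hPw hcs
  generalize (c - 1) • P *ᵥ x + s • w = u at hPu huu
  rw [transpose_add, transpose_vecMulVec, Matrix.add_mul, Matrix.mul_add, Matrix.mul_add, hP,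
    mul_vecMulVec, hPu, vecMulVec_mul, ← mulVec_transpose, hPu, vecMulVec_mul_vecMulVec, huu]
  ext i j
  simp [vecMulVec_apply]
  ring

end RankOne

lemma eventually_rotation_le {p q b δ : ℝ} (hδ : 0 < δ)
    (h : ∀ θ : ℝ, 2 - 2 * Real.cos θ < δ →
      Real.cos θ ^ 2 * p + 2 * (Real.cos θ * Real.sin θ) * b + Real.sin θ ^ 2 * q ≤ p) :
    b = 0 ∧ q ≤ p := by
  have hev : ∀ᶠ θ : ℝ in nhds 0, 2 - 2 * Real.cos θ < δ := by
    have : ContinuousAt (fun θ : ℝ => 2 - 2 * Real.cos θ) 0 := by fun_prop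
    exact this.eventually_lt continuousAt_const (by simpa using hδ)
  have hb : b = 0 := by
    have hmax : IsLocalMax (fun θ : ℝ => Real.cos θ ^ 2 * p +
        2 * (Real.cos θ * Real.sin θ) * b + Real.sin θ ^ 2 * q) 0 := by
      filter_upwards [hev] with θ hθ
      simpa using h θ hθ
    have hder := ((((Real.hasDerivAt_cos 0).pow 2).mul_const p).add
      ((((Real.hasDerivAt_cos 0).mul (Real.hasDerivAt_sin 0)).const_mul 2).mul_const b)).add
      (((Real.hasDerivAt_sin 0).pow 2).mul_const q)
    have := hmax.hasDerivAt_eq_zero hder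
    simpa using this
  refine ⟨hb, ?_⟩
  subst hb
  obtain ⟨η, hη, hball⟩ := Metric.eventually_nhds_iff.1 hev
  have hθ : 0 < min (η / 2) 1 := by positivity
  have hs : 0 < Real.sin (min (η / 2) 1) :=
    Real.sin_pos_of_pos_of_lt_pi hθ (by linarith [min_le_right (η / 2) 1, Real.pi_gt_three])
  have := h _ (hball (y := min (η / 2) 1) (by
    rw [Real.dist_eq, sub_zero, abs_of_pos hθ]; linarith [min_le_left (η / 2) 1]))
  have hcs := Real.sin_sq_add_cos_sq (min (η / 2) 1)
  have hsq : 0 < Real.sin (min (η / 2) 1) ^ 2 := by positivity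
  refine le_of_mul_le_mul_left ?_ hsq
  linear_combination this - p * hcs

lemma trace_le_of_decomposition {n d : ℕ} {N K : Matrix (Fin n) (Fin n) ℝ}
    {C : Matrix (Fin d) (Fin d) ℝ} {P : Matrix (Fin n) (Fin d) ℝ} (hP : Pᵀ * P = 1)
    (hC : C.PosSemidef) (hK : K.PosSemidef) (hN : N = P * C * Pᵀ - K)
    {Q : Matrix (Fin n) (Fin d) ℝ} (hQ : Qᵀ * Q = 1) :
    (Qᵀ * N * Q).trace ≤ C.trace := by
  have h₁ : 0 ≤ (Qᵀ * K * Q).trace := by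
    simpa using (hK.conjTranspose_mul_mul_same Q).trace_nonneg
  have hsq : (P - Q * Qᵀ * P)ᵀ * (P - Q * Qᵀ * P) = 1 - Pᵀ * Q * Qᵀ * P := by
    have : Qᵀ * (Q * (Qᵀ * P)) = Qᵀ * P := by rw [← Matrix.mul_assoc, hQ, Matrix.one_mul]
    simp only [transpose_sub, transpose_mul, transpose_transpose, Matrix.sub_mul, Matrix.mul_sub,
      Matrix.mul_assoc, hP, this]
    simp
  have h₂ : 0 ≤ ((P - Q * Qᵀ * P) * C * (P - Q * Qᵀ * P)ᵀ).trace := by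
    simpa only [conjTranspose_eq_transpose_of_trivial] using
      (hC.mul_mul_conjTranspose_same (P - Q * Qᵀ * P)).trace_nonneg
  rw [trace_mul_comm, ← Matrix.mul_assoc, hsq, Matrix.sub_mul, Matrix.one_mul, trace_sub] at h₂
  have h₃ : (Qᵀ * (P * C * Pᵀ) * Q).trace = (Pᵀ * Q * Qᵀ * P * C).trace := by
    rw [trace_mul_comm, ← Matrix.mul_assoc, ← Matrix.mul_assoc, ← Matrix.mul_assoc, trace_mul_comm]
    simp only [Matrix.mul_assoc]
  rw [hN, Matrix.mul_sub, Matrix.sub_mul, trace_sub, h₃]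
  linarith

section LocalMax

variable {n d : ℕ} {M : Matrix (Fin n) (Fin n) ℝ} {P : Matrix (Fin n) (Fin d) ℝ}

lemma exists_smul_dotProduct_self_eq_one {m : ℕ} {v : Fin m → ℝ} (hv : v ≠ 0) :
    ∃ (r : ℝ) (u : Fin m → ℝ), v = r • u ∧ u ⬝ᵥ u = 1 := by
  have hpos : 0 < v ⬝ᵥ v := by simpa using dotProduct_star_self_pos_iff.2 hv
  have hr := Real.mul_self_sqrt hpos.le
  have hr0 : Real.sqrt (v ⬝ᵥ v) ≠ 0 := (Real.sqrt_pos.2 hpos).ne'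
  refine ⟨Real.sqrt (v ⬝ᵥ v), (Real.sqrt (v ⬝ᵥ v))⁻¹ • v, (smul_inv_smul₀ hr0 v).symm, ?_⟩
  simp only [smul_dotProduct, dotProduct_smul, smul_eq_mul]
  generalize Real.sqrt (v ⬝ᵥ v) = r at hr hr0
  rw [← hr]
  field_simp

lemma critical_of_isLocalMax (hM : Mᵀ = M) (hP : Pᵀ * P = 1) {ε : ℝ} (hε : 0 < ε)
    (hloc : ∀ Q : Matrix (Fin n) (Fin d) ℝ, Qᵀ * Q = 1 →
      Real.sqrt (((Q - P)ᵀ * (Q - P)).trace) < ε →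
      (Qᵀ * M * Q).trace ≤ (Pᵀ * M * P).trace)
    {x : Fin d → ℝ} (hx : x ⬝ᵥ x = 1) {w : Fin n → ℝ} (hw : w ⬝ᵥ w = 1) (hPw : Pᵀ *ᵥ w = 0) :
    w ⬝ᵥ M *ᵥ (P *ᵥ x) = 0 ∧ w ⬝ᵥ M *ᵥ w ≤ (P *ᵥ x) ⬝ᵥ M *ᵥ (P *ᵥ x) := by
  refine eventually_rotation_le (δ := ε ^ 2) (by positivity) fun θ hθ => ?_
  have hcs : Real.cos θ ^ 2 + Real.sin θ ^ 2 = 1 := Real.cos_sq_add_sin_sq θ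
  have h := hloc _ (add_vecMulVec_orthonormal hP hx hw hPw hcs) (by
    rw [add_sub_cancel_left, transpose_vecMulVec, vecMulVec_mul_vecMulVec, trace_vecMulVec,
      dotProduct_smul, hx, rotation_dotProduct_self hP hx hw hPw hcs, smul_eq_mul, mul_one]
    exact (Real.sqrt_lt' hε).2 hθ)
  have hsymm : (P *ᵥ x) ⬝ᵥ M *ᵥ w = w ⬝ᵥ M *ᵥ (P *ᵥ x) := by
    rw [dotProduct_mulVec, ← mulVec_transpose, hM, dotProduct_comm]
  rw [trace_quadratic_add_vecMulVec hM, hx] at h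
  simp only [mulVec_add, mulVec_smul, add_dotProduct, dotProduct_add, smul_dotProduct,
    dotProduct_smul, smul_eq_mul, hsymm] at h
  linear_combination h

lemma exists_separating_level (hd : 0 < d) (hM : M.PosSemidef)
    (hcrit : ∀ x : Fin d → ℝ, x ⬝ᵥ x = 1 → ∀ w : Fin n → ℝ, w ⬝ᵥ w = 1 → Pᵀ *ᵥ w = 0 →
      w ⬝ᵥ M *ᵥ w ≤ (P *ᵥ x) ⬝ᵥ M *ᵥ (P *ᵥ x)) :
    ∃ μ : ℝ, (∀ x : Fin d → ℝ, μ * (x ⬝ᵥ x) ≤ (P *ᵥ x) ⬝ᵥ M *ᵥ (P *ᵥ x)) ∧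
      ∀ w : Fin n → ℝ, Pᵀ *ᵥ w = 0 → w ⬝ᵥ M *ᵥ w ≤ μ * (w ⬝ᵥ w) := by
  set S : Set ℝ := (fun x : Fin d → ℝ => (P *ᵥ x) ⬝ᵥ M *ᵥ (P *ᵥ x)) '' {x | x ⬝ᵥ x = 1}
  have hbdd : BddBelow S := by
    refine ⟨0, ?_⟩
    rintro _ ⟨x, -, rfl⟩
    simpa using hM.dotProduct_mulVec_nonneg (P *ᵥ x)
  have hne : S.Nonempty := ⟨_, Pi.single ⟨0, hd⟩ 1, by simp, rfl⟩
  refine ⟨sInf S, fun x => ?_, fun w hw => ?_⟩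
  · rcases eq_or_ne x 0 with rfl | hx
    · simp
    obtain ⟨r, u, rfl, hu⟩ := exists_smul_dotProduct_self_eq_one hx
    have := csInf_le hbdd ⟨u, hu, rfl⟩
    simp only [mulVec_smul, smul_dotProduct, dotProduct_smul, smul_eq_mul, hu]
    nlinarith [mul_le_mul_of_nonneg_left this (mul_self_nonneg r)]
  · rcases eq_or_ne w 0 with rfl | hw0
    · simp
    obtain ⟨r, u, rfl, hu⟩ := exists_smul_dotProduct_self_eq_one hw0
    have hr : r ≠ 0 := by rintro rfl; simp at hw0
    have hPu : Pᵀ *ᵥ u = 0 := by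
      rw [mulVec_smul] at hw
      exact (smul_eq_zero.1 hw).resolve_left hr
    have : u ⬝ᵥ M *ᵥ u ≤ sInf S := le_csInf hne (by
      rintro _ ⟨x, hx, rfl⟩
      exact hcrit x hx u hu hPu)
    simp only [mulVec_smul, smul_dotProduct, dotProduct_smul, smul_eq_mul, hu]
    nlinarith [mul_le_mul_of_nonneg_left this (mul_self_nonneg r)]

lemma mul_eq_of_forall_orthogonal (hP : Pᵀ * P = 1)
    (hcrit : ∀ x : Fin d → ℝ, x ⬝ᵥ x = 1 → ∀ w : Fin n → ℝ, w ⬝ᵥ w = 1 → Pᵀ *ᵥ w = 0 →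
      w ⬝ᵥ M *ᵥ (P *ᵥ x) = 0) :
    M * P = P * (Pᵀ * M * P) := by
  have horth (x : Fin d → ℝ) (hx : x ⬝ᵥ x = 1) (w : Fin n → ℝ) (hw : Pᵀ *ᵥ w = 0) :
      w ⬝ᵥ M *ᵥ (P *ᵥ x) = 0 := by
    rcases eq_or_ne w 0 with rfl | hw0
    · simp
    obtain ⟨r, u, rfl, hu⟩ := exists_smul_dotProduct_self_eq_one hw0
    have hr : r ≠ 0 := by rintro rfl; simp at hw0
    rw [mulVec_smul] at hw
    rw [smul_dotProduct, hcrit x hx u hu ((smul_eq_zero.1 hw).resolve_left hr), smul_zero]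
  ext i j
  have hE : Pᵀ * (M * P - P * (Pᵀ * M * P)) = 0 := by
    rw [Matrix.mul_sub, ← Matrix.mul_assoc, ← Matrix.mul_assoc, hP, Matrix.one_mul, sub_self]
  set w : Fin n → ℝ := (M * P - P * (Pᵀ * M * P)) *ᵥ Pi.single j 1 with hwdef
  have hw : Pᵀ *ᵥ w = 0 := by rw [hwdef, mulVec_mulVec, hE, zero_mulVec]
  have h₁ := horth (Pi.single j 1) (by simp) w hw
  have h₂ : w ⬝ᵥ (P * (Pᵀ * M * P)) *ᵥ Pi.single j 1 = 0 := by
    rw [← mulVec_mulVec, dotProduct_mulVec, ← mulVec_transpose, hw, zero_dotProduct]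
  have h₃ : w ⬝ᵥ w = 0 := by
    have := congrArg (w ⬝ᵥ ·) hwdef
    simpa only [sub_mulVec, dotProduct_sub, ← mulVec_mulVec _ M, h₁, h₂, sub_zero] using this
  have h₄ := congrFun (dotProduct_self_eq_zero.1 h₃) i
  rw [hwdef, mulVec_single_one] at h₄
  simpa [sub_eq_zero] using h₄

lemma trace_le_of_isLocalMax (hd : 0 < d) (hM : M.PosSemidef) (hP : Pᵀ * P = 1)
    {ε : ℝ} (hε : 0 < ε)
    (hloc : ∀ Q : Matrix (Fin n) (Fin d) ℝ, Qᵀ * Q = 1 →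
      Real.sqrt (((Q - P)ᵀ * (Q - P)).trace) < ε →
      (Qᵀ * M * Q).trace ≤ (Pᵀ * M * P).trace)
    {Q : Matrix (Fin n) (Fin d) ℝ} (hQ : Qᵀ * Q = 1) :
    (Qᵀ * M * Q).trace ≤ (Pᵀ * M * P).trace := by
  have hMt : Mᵀ = M := by simpa using hM.1.eq
  have hcrit (x : Fin d → ℝ) (hx : x ⬝ᵥ x = 1) (w : Fin n → ℝ) (hw : w ⬝ᵥ w = 1)
      (hPw : Pᵀ *ᵥ w = 0) := critical_of_isLocalMax hMt hP hε hloc hx hw hPw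
  obtain ⟨μ, hμP, hμ⟩ := exists_separating_level hd hM fun x hx w hw hPw => (hcrit x hx w hw hPw).2
  have hMP := mul_eq_of_forall_orthogonal hP fun x hx w hw hPw => (hcrit x hx w hw hPw).1
  have hPM : Pᵀ * M = Pᵀ * M * P * Pᵀ := by
    have := congrArg transpose hMP
    simpa only [transpose_mul, transpose_transpose, hMt, Matrix.mul_assoc] using this
  have hC : (Pᵀ * M * P - μ • (1 : Matrix (Fin d) (Fin d) ℝ)).PosSemidef := by
    refine .of_dotProduct_mulVec_nonneg ?_ fun x => ?_
    · rw [IsHermitian, conjTranspose_eq_transpose_of_trivial]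
      simp [transpose_mul, hMt, Matrix.mul_assoc]
    · have h : x ⬝ᵥ (Pᵀ * M * P) *ᵥ x = (P *ᵥ x) ⬝ᵥ M *ᵥ (P *ᵥ x) := by
        rw [Matrix.mul_assoc, ← mulVec_mulVec, dotProduct_mulVec, vecMul_transpose, mulVec_mulVec]
      rw [star_trivial, sub_mulVec, smul_mulVec, one_mulVec, dotProduct_sub, dotProduct_smul,
        smul_eq_mul, h]
      exact sub_nonneg.2 (hμP x)
  set E : Matrix (Fin n) (Fin n) ℝ := 1 - P * Pᵀ with hE
  have hEt : Eᵀ = E := by simp [hE]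
  have hPE : Pᵀ * E = 0 := by
    rw [hE, Matrix.mul_sub, ← Matrix.mul_assoc, hP]; simp
  have hK : (E * (μ • (1 : Matrix (Fin n) (Fin n) ℝ) - M) * E).PosSemidef := by
    refine .of_dotProduct_mulVec_nonneg ?_ fun x => ?_
    · rw [IsHermitian, conjTranspose_eq_transpose_of_trivial]
      simp [transpose_mul, hMt, hEt, Matrix.mul_assoc]
    · have := hμ (E *ᵥ x) (by rw [mulVec_mulVec, hPE, zero_mulVec])
      rw [star_trivial, ← mulVec_mulVec, ← mulVec_mulVec, dotProduct_mulVec, ← mulVec_transpose,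
        hEt]
      generalize E *ᵥ x = y at this ⊢
      rw [sub_mulVec, smul_mulVec, one_mulVec, dotProduct_sub, dotProduct_smul, smul_eq_mul]
      exact sub_nonneg.2 this
  have hN : M - μ • (1 : Matrix (Fin n) (Fin n) ℝ) =
      P * (Pᵀ * M * P - μ • (1 : Matrix (Fin d) (Fin d) ℝ)) * Pᵀ -
        E * (μ • (1 : Matrix (Fin n) (Fin n) ℝ) - M) * E := by
    have hEMP : E * M * P = 0 := by
      rw [Matrix.mul_assoc, hMP, ← Matrix.mul_assoc, hE, Matrix.sub_mul, Matrix.mul_assoc P, hP]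
      simp
    have hEE : E * E = E := by
      nth_rw 1 [hE]
      rw [Matrix.sub_mul, Matrix.mul_assoc, hPE]; simp
    have hEME : E * M * E = E * M := by
      nth_rw 2 [hE]
      rw [Matrix.mul_sub, ← Matrix.mul_assoc, hEMP]; simp
    rw [Matrix.mul_sub E, Matrix.sub_mul, hEME, Matrix.mul_smul, Matrix.smul_mul, Matrix.mul_one,
      hEE, Matrix.mul_sub, Matrix.sub_mul, Matrix.mul_smul, Matrix.smul_mul, Matrix.mul_one,
      Matrix.mul_assoc P, ← hPM, hE, Matrix.sub_mul, Matrix.one_mul, smul_sub, Matrix.mul_assoc]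
    abel
  have h := trace_le_of_decomposition hP hC hK hN hQ
  rw [Matrix.mul_sub, Matrix.sub_mul, Matrix.mul_smul, Matrix.smul_mul, Matrix.mul_one, hQ,
    trace_sub, trace_sub] at h
  linarith

end LocalMax

section Eigenvalues

variable {n d : ℕ}

lemma eigsDesc_antitone {M : Matrix (Fin n) (Fin n) ℝ} (hM : M.IsHermitian) :
    Antitone (eigsDesc hM) := fun _ _ h =>
  Tuple.monotone_sort hM.eigenvalues (Fin.rev_le_rev.2 h)

lemma exists_orthogonal_diagonalization_eigsDesc {M : Matrix (Fin n) (Fin n) ℝ}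
    (hM : M.IsHermitian) :
    ∃ W : Matrix (Fin n) (Fin n) ℝ, Wᵀ * W = 1 ∧ Wᵀ * M * W = diagonal (eigsDesc hM) := by
  set U : Matrix (Fin n) (Fin n) ℝ := hM.eigenvectorUnitary.1 with hU
  have hUU : Uᵀ * U = 1 := by
    simpa [star_eq_conjTranspose] using Unitary.coe_star_mul_self hM.eigenvectorUnitary
  have hdiag : Uᵀ * M * U = diagonal hM.eigenvalues := by
    have := hM.conjStarAlgAut_star_eigenvectorUnitary
    rw [Unitary.conjStarAlgAut_star_apply] at this
    simpa [star_eq_conjTranspose, ← hU, Function.comp_def] using this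
  let σ : Equiv.Perm (Fin n) := Fin.revPerm.trans (Tuple.sort hM.eigenvalues)
  have hsub (B : Matrix (Fin n) (Fin n) ℝ) :
      (U.submatrix id σ)ᵀ * B * U.submatrix id σ = (Uᵀ * B * U).submatrix σ σ := by
    ext i j
    simp [Matrix.mul_apply]
  refine ⟨U.submatrix id σ, ?_, ?_⟩
  · have := hsub 1
    rw [Matrix.mul_one, Matrix.mul_one, hUU] at this
    rw [this, submatrix_one_equiv]
  · rw [hsub, hdiag, submatrix_diagonal_equiv]
    rfl

lemma sum_mul_le_sum_filter_lt {l w : Fin n → ℝ} (hd : 0 < d) (hdn : d ≤ n) (hl : Antitone l)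
    (hw₀ : ∀ i, 0 ≤ w i) (hw₁ : ∀ i, w i ≤ 1) (hw : ∑ i, w i = d) :
    ∑ i, l i * w i ≤ ∑ i ∈ Finset.univ.filter (fun i : Fin n => (i : ℕ) < d), l i := by
  set μ := l ⟨d - 1, by omega⟩
  have hcard : ((Finset.univ.filter (fun i : Fin n => (i : ℕ) < d)).card : ℝ) = d := by
    rw [Fin.card_filter_val_lt, min_eq_right hdn]
  have h : ∑ i, (l i - μ) * w i ≤
      ∑ i ∈ Finset.univ.filter (fun i : Fin n => (i : ℕ) < d), (l i - μ) := by
    rw [Finset.sum_filter]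
    refine Finset.sum_le_sum fun i _ => ?_
    split_ifs with hi
    · have : μ ≤ l i := hl (Fin.le_def.2 (by simp; omega))
      nlinarith [hw₁ i]
    · have : l i ≤ μ := hl (Fin.le_def.2 (by simp; omega))
      nlinarith [hw₀ i]
  simp only [sub_mul, Finset.sum_sub_distrib, ← Finset.mul_sum, hw, Finset.sum_const, hcard,
    nsmul_eq_mul] at h
  linarith

lemma trace_le_sum_eigsDesc {M : Matrix (Fin n) (Fin n) ℝ} (hM : M.IsHermitian)
    (hd : 0 < d) (hdn : d ≤ n) {Q : Matrix (Fin n) (Fin d) ℝ} (hQ : Qᵀ * Q = 1) :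
    (Qᵀ * M * Q).trace ≤
      ∑ i ∈ Finset.univ.filter (fun i : Fin n => (i : ℕ) < d), eigsDesc hM i := by
  obtain ⟨W, hW, hdiag⟩ := exists_orthogonal_diagonalization_eigsDesc hM
  have hW' : W * Wᵀ = 1 := mul_eq_one_comm.1 hW
  set R := Wᵀ * Q with hR
  have hRR : Rᵀ * R = 1 := by
    rw [hR, transpose_mul, transpose_transpose, Matrix.mul_assoc, ← Matrix.mul_assoc W, hW',
      Matrix.one_mul, hQ]
  have hQR : Q = W * R := by rw [hR, ← Matrix.mul_assoc, hW', Matrix.one_mul]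
  have htrace : (Qᵀ * M * Q).trace = ∑ i, eigsDesc hM i * (R * Rᵀ) i i := by
    have : Qᵀ * M * Q = Rᵀ * (diagonal (eigsDesc hM) * R) := by
      rw [hQR, ← hdiag, transpose_mul]
      simp only [Matrix.mul_assoc]
    rw [this, trace_mul_comm, Matrix.mul_assoc, trace]
    simp [diagonal_mul]
  rw [htrace]
  refine sum_mul_le_sum_filter_lt hd hdn (eigsDesc_antitone hM) (fun i => ?_) (fun i => ?_) ?_
  · rw [Matrix.mul_apply]
    exact Finset.sum_nonneg fun j _ => mul_self_nonneg (R i j)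
  · have hproj : (1 - R * Rᵀ) * (1 - R * Rᵀ)ᵀ = 1 - R * Rᵀ := by
      have : R * (Rᵀ * (R * Rᵀ)) = R * Rᵀ := by rw [← Matrix.mul_assoc Rᵀ, hRR, Matrix.one_mul]
      simp [Matrix.mul_sub, Matrix.sub_mul, Matrix.mul_assoc, this]
    have h := congrFun (congrFun hproj i) i
    rw [Matrix.mul_apply] at h
    have h₀ : 0 ≤ ∑ j, (1 - R * Rᵀ : Matrix (Fin n) (Fin n) ℝ) i j *
        (1 - R * Rᵀ : Matrix (Fin n) (Fin n) ℝ)ᵀ j i :=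
      Finset.sum_nonneg fun j _ => mul_self_nonneg ((1 - R * Rᵀ : Matrix (Fin n) (Fin n) ℝ) i j)
    rw [h, Matrix.sub_apply, one_apply_eq] at h₀
    linarith
  · have : (R * Rᵀ).trace = d := by rw [trace_mul_comm, hRR, trace_one, Fintype.card_fin]
    exact this

lemma exists_trace_eq_sum_eigsDesc {M : Matrix (Fin n) (Fin n) ℝ} (hM : M.IsHermitian)
    (hdn : d ≤ n) :
    ∃ Q : Matrix (Fin n) (Fin d) ℝ, Qᵀ * Q = 1 ∧ (Qᵀ * M * Q).trace =
      ∑ i ∈ Finset.univ.filter (fun i : Fin n => (i : ℕ) < d), eigsDesc hM i := by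
  obtain ⟨W, hW, hdiag⟩ := exists_orthogonal_diagonalization_eigsDesc hM
  have hsub (B : Matrix (Fin n) (Fin n) ℝ) :
      (W.submatrix id (Fin.castLE hdn))ᵀ * B * W.submatrix id (Fin.castLE hdn) =
        (Wᵀ * B * W).submatrix (Fin.castLE hdn) (Fin.castLE hdn) := by
    ext i j
    simp [Matrix.mul_apply]
  refine ⟨W.submatrix id (Fin.castLE hdn), ?_, ?_⟩
  · have := hsub 1
    rw [Matrix.mul_one, Matrix.mul_one, hW] at this
    rw [this, submatrix_one _ (Fin.castLE_injective hdn)]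
  · rw [hsub, hdiag, submatrix_diagonal _ _ (Fin.castLE_injective hdn), trace_diagonal]
    refine Finset.sum_bij (fun i _ => Fin.castLE hdn i) (by simp)
      (fun _ _ _ _ h => Fin.castLE_injective hdn h) (fun i hi => ?_) (fun _ _ => rfl)
    exact ⟨⟨i, (Finset.mem_filter.1 hi).2⟩, Finset.mem_univ _, rfl⟩

end Eigenvalues

/-- Any local maximum of `P ↦ ‖AP‖_F²` on the set of matrices with
`d` orthonormal columns is a global maximum, whose value is the sum of the `d`
largest eigenvalues of `AᵀA`. -/
theorem stmt9 {a n d : ℕ} (hd : 0 < d) (hdn : d ≤ n)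
    (A : Matrix (Fin a) (Fin n) ℝ)
    (P : Matrix (Fin n) (Fin d) ℝ) (hP : Pᵀ * P = 1)
    (ε : ℝ) (hε : 0 < ε)
    (hAtA : (Aᵀ * A).IsHermitian)
    (hloc : ∀ Q : Matrix (Fin n) (Fin d) ℝ, Qᵀ * Q = 1 →
      Real.sqrt (((Q - P)ᵀ * (Q - P)).trace) < ε →
      ((A * Q)ᵀ * (A * Q)).trace ≤ ((A * P)ᵀ * (A * P)).trace) :
    (∀ Q : Matrix (Fin n) (Fin d) ℝ, Qᵀ * Q = 1 →
      ((A * Q)ᵀ * (A * Q)).trace ≤ ((A * P)ᵀ * (A * P)).trace) ∧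
    ((A * P)ᵀ * (A * P)).trace =
      ∑ i ∈ Finset.univ.filter (fun i : Fin n => (i : ℕ) < d), eigsDesc hAtA i := by
  have hgram (Q : Matrix (Fin n) (Fin d) ℝ) : (A * Q)ᵀ * (A * Q) = Qᵀ * (Aᵀ * A) * Q := by
    simp only [transpose_mul, Matrix.mul_assoc]
  simp only [hgram] at hloc ⊢
  have hpsd : (Aᵀ * A).PosSemidef := by simpa using posSemidef_conjTranspose_mul_self A
  have hmax (Q : Matrix (Fin n) (Fin d) ℝ) (hQ : Qᵀ * Q = 1) :=
    trace_le_of_isLocalMax hd hpsd hP hε hloc hQ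
  refine ⟨hmax, le_antisymm (trace_le_sum_eigsDesc hAtA hd hdn hP) ?_⟩
  obtain ⟨Q, hQ, hQtr⟩ := exists_trace_eq_sum_eigsDesc hAtA hdn
  exact hQtr ▸ hmax Q hQ
end

section
/- For any positive integers n, d, s with d ≤ n and 1 ≤ s ≤ n − d, there exist m = (s+1)(s+2)/2 − 1 real n×n matrices A_1, …, A_m, a real n×n matrix C, scalars b_1, …, b_m ∈ ℝ, and relations ⊲_i ∈ {≤, ≥, =} such that the semidefinite program SDP(I): minimize ⟨C, X⟩ over symmetric X subject to ⟨A_i, X⟩ ⊲_i b_i for all i, tr(X) ≤ d, 0 ⪯ X ⪯ I_n, has a nonempty feasible set, and every optimal solution of SDP(I) has rank at least d + s. In particular, the rank bound d + ⌊√(2m + 9/4) − 3/2⌋ for extreme optimal solutions of SDP(I) cannot be improved. -/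
open Matrix

/-- A positive semidefinite real matrix with a zero diagonal entry vanishes on that row. -/
theorem Matrix.PosSemidef.apply_eq_zero_of_diag_eq_zero {n : Type*} [Fintype n]
    {M : Matrix n n ℝ} (hM : M.PosSemidef) {i : n} (hi : M i i = 0) (j : n) : M i j = 0 := by
  have hdet := (hM.submatrix ![i, j]).det_nonneg
  have hsymm : M j i = M i j := by simpa using hM.isHermitian.apply i j
  simp only [det_fin_two, submatrix_apply, cons_val_zero, cons_val_one, hi, hsymm] at hdet
  nlinarith

/-- A matrix with a diagonal principal submatrix having no zero diagonal entry has rank at least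
the size of that submatrix. -/
theorem Matrix.card_le_rank_of_submatrix_eq_diagonal {m n K : Type*} [Fintype m] [DecidableEq m]
    [Fintype n] [Field K] {M : Matrix n n K} (e : m → n) {v : m → K}
    (h : M.submatrix e e = diagonal v) (hv : ∀ i, v i ≠ 0) : Fintype.card m ≤ M.rank := by
  classical
  calc Fintype.card m = (M.submatrix e e).rank := by
        rw [h, rank_diagonal, Fintype.card_subtype]
        simp [hv]
    _ ≤ M.rank := rank_submatrix_le M e e

theorem Sym2.card_ne {α : Type*} [Fintype α] [DecidableEq α] (z : Sym2 α) :
    Fintype.card {w : Sym2 α // w ≠ z} =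
      Fintype.card α * (Fintype.card α + 1) / 2 - 1 := by
  rw [Fintype.card_subtype_compl, Fintype.card_subtype_eq, Sym2.card, Nat.choose_two_right,
    Nat.add_sub_cancel, mul_comm]

/-- The diagonal of the optimal solutions. -/
noncomputable def optimalDiag (d s i : ℕ) : ℝ :=
  if i < s + 1 then 1 / (s + 1) else if i < d + s then 1 else 0

/-- The diagonal entries of the negated cost matrix. -/
def rewardDiag (d s i : ℕ) : ℝ :=
  if i < s then 0 else if i = s then 1 else if i < d + s then 2 else 0

theorem optimalDiag_nonneg (d s i : ℕ) : 0 ≤ optimalDiag d s i := by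
  unfold optimalDiag
  split_ifs <;> positivity

theorem optimalDiag_le_one (d s i : ℕ) : optimalDiag d s i ≤ 1 := by
  unfold optimalDiag
  split_ifs
  · rw [div_le_one (by positivity)]
    linarith [(Nat.cast_nonneg s : (0 : ℝ) ≤ s)]
  · exact le_rfl
  · exact zero_le_one

theorem optimalDiag_pos {d s i : ℕ} (hi : i < d + s) : 0 < optimalDiag d s i := by
  unfold optimalDiag
  split_ifs <;> positivity

theorem sum_optimalDiag {n d s : ℕ} (hd : 0 < d) (hn : d + s ≤ n) :
    ∑ i : Fin n, optimalDiag d s i = d := by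
  have key (i : Fin n) : optimalDiag d s i =
      (if (i : ℕ) < d + s then 1 else 0) - (s / (s + 1)) * (if (i : ℕ) < s + 1 then 1 else 0) := by
    have hs : (s : ℝ) + 1 ≠ 0 := by positivity
    unfold optimalDiag
    split_ifs <;> first | omega | (field_simp; ring)
  simp_rw [key]
  rw [Finset.sum_sub_distrib, ← Finset.mul_sum, Finset.sum_boole, Finset.sum_boole,
    Fin.card_filter_val_lt, Fin.card_filter_val_lt, min_eq_right hn,
    min_eq_right (by omega : s + 1 ≤ n)]
  push_cast
  field_simp
  ring

/-- Among the diagonals with entries in `[0, 1]`, total mass at most `d` and the first `s` entries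
prescribed, those with maximal reward agree with `optimalDiag` off `s` and dominate it at `s`. -/
theorem optimalDiag_of_reward_le {n d s : ℕ} (hd : 0 < d) (hn : d + s ≤ n) {x : Fin n → ℝ}
    (h0 : ∀ i, 0 ≤ x i) (h1 : ∀ i, x i ≤ 1) (hsum : ∑ i, x i ≤ d)
    (hfix : ∀ i : Fin n, (i : ℕ) < s → x i = optimalDiag d s i)
    (hrew : ∑ i : Fin n, rewardDiag d s i * optimalDiag d s i ≤
      ∑ i : Fin n, rewardDiag d s i * x i) :
    (∀ i : Fin n, (i : ℕ) ≠ s → x i = optimalDiag d s i) ∧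
      ∀ i : Fin n, optimalDiag d s i ≤ x i := by
  have hnonpos (i : Fin n) (_ : i ∈ Finset.univ) :
      (rewardDiag d s i - 1) * (x i - optimalDiag d s i) ≤ 0 := by
    have hx0 := h0 i
    have hx1 := h1 i
    rcases lt_trichotomy (i : ℕ) s with hi | hi | hi
    · simp [hfix i hi]
    · simp [rewardDiag, hi]
    · unfold rewardDiag optimalDiag
      split_ifs <;> first | omega | linarith
  have htotal : ∑ i : Fin n, (rewardDiag d s i - 1) * (x i - optimalDiag d s i) = 0 := by
    refine le_antisymm (Finset.sum_nonpos hnonpos) ?_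
    have hopt := sum_optimalDiag hd hn
    simp only [sub_mul, mul_sub, one_mul, Finset.sum_sub_distrib]
    linarith
  have hne (i : Fin n) (hi : (i : ℕ) ≠ s) : x i = optimalDiag d s i := by
    have hzero := (Finset.sum_eq_zero_iff_of_nonpos hnonpos).1 htotal i (Finset.mem_univ i)
    rcases lt_or_gt_of_ne hi with hlt | hgt
    · exact hfix i hlt
    · have hcoef : rewardDiag d s i - 1 ≠ 0 := by
        unfold rewardDiag
        split_ifs <;> first | omega | norm_num
      exact sub_eq_zero.1 ((mul_eq_zero.1 hzero).resolve_left hcoef)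
  refine ⟨hne, fun i => ?_⟩
  by_cases hi : (i : ℕ) = s
  · have hsingle : ∑ j : Fin n, rewardDiag d s j * (x j - optimalDiag d s j) =
        rewardDiag d s i * (x i - optimalDiag d s i) := by
      refine Finset.sum_eq_single i (fun j _ hj => ?_) (by simp)
      rw [hne j fun h => hj (Fin.ext (h.trans hi.symm)), sub_self, mul_zero]
    have hcoef : rewardDiag d s i = 1 := by simp [rewardDiag, hi]
    simp only [mul_sub, Finset.sum_sub_distrib, hcoef, one_mul] at hsingle
    linarith
  · exact (hne i hi).ge

theorem rank_ge_of_reward_le {n d s : ℕ} (hd : 0 < d) (hn : d + s ≤ n)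
    {X : Matrix (Fin n) (Fin n) ℝ} (hX : X.PosSemidef) (hX1 : (1 - X).PosSemidef)
    (htr : X.trace ≤ d)
    (hfix : ∀ i j : Fin n, (i : ℕ) < s + 1 → (j : ℕ) < s + 1 → ¬((i : ℕ) = s ∧ (j : ℕ) = s) →
      X i j = diagonal (fun k : Fin n => optimalDiag d s k) i j)
    (hrew : ∑ i : Fin n, rewardDiag d s i * optimalDiag d s i ≤
      ∑ i : Fin n, rewardDiag d s i * X i i) :
    d + s ≤ X.rank := by
  have hsymm (i j : Fin n) : X j i = X i j := by simpa using hX.isHermitian.apply i j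
  obtain ⟨hdiag, hle⟩ := optimalDiag_of_reward_le hd hn (x := fun i => X i i)
    (fun i => hX.diag_nonneg) (fun i => by simpa using hX1.diag_nonneg (i := i)) htr
    (fun i hi => by simpa using hfix i i (by omega) (by omega) (by omega)) hrew
  have hrow (i j : Fin n) (hi : s < i) (hi' : (i : ℕ) < d + s) (hij : i ≠ j) : X i j = 0 := by
    have hone : X i i = 1 := by
      have h := hdiag i hi.ne'
      rwa [optimalDiag, if_neg (by omega), if_pos hi'] at h
    have := hX1.apply_eq_zero_of_diag_eq_zero (i := i) (by simp [hone]) j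
    simpa [hij] using this
  have hoff (i j : Fin n) (hi : (i : ℕ) < d + s) (hj : (j : ℕ) < d + s) (hij : i ≠ j) :
      X i j = 0 := by
    by_cases hi' : s < i
    · exact hrow i j hi' hi hij
    by_cases hj' : s < j
    · rw [← hsymm]
      exact hrow j i hj' hj hij.symm
    · rw [hfix i j (by omega) (by omega) (by omega), diagonal_apply_ne _ hij]
  have hsub : X.submatrix (Fin.castLE hn) (Fin.castLE hn) =
      diagonal fun k => X (Fin.castLE hn k) (Fin.castLE hn k) := by
    ext i j
    by_cases hij : i = j
    · simp [hij]
    · rw [submatrix_apply, diagonal_apply_ne _ hij]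
      exact hoff _ _ i.2 j.2 fun h => hij (Fin.castLE_injective hn h)
  simpa using card_le_rank_of_submatrix_eq_diagonal _ hsub fun k =>
    ((optimalDiag_pos (i := (Fin.castLE hn k : Fin n)) k.2).trans_le (hle _)).ne'

/-- Tightness of the rank bound: for any `n, d, s` with `d ≤ n`,
`1 ≤ s` and `d + s ≤ n`, there is an SDP instance with
`m = (s+1)(s+2)/2 − 1` constraints whose feasible set is nonempty and all of
whose optimal solutions have rank at least `d + s`. -/
theorem stmt16 {n d s : ℕ} (hd : 0 < d) (hdn : d ≤ n) (hs : 1 ≤ s)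
    (hsnd : s ≤ n - d) :
    ∃ (A : Fin ((s + 1) * (s + 2) / 2 - 1) → Matrix (Fin n) (Fin n) ℝ)
      (C : Matrix (Fin n) (Fin n) ℝ)
      (b : Fin ((s + 1) * (s + 2) / 2 - 1) → ℝ)
      (rel : Fin ((s + 1) * (s + 2) / 2 - 1) → ℝ → ℝ → Prop),
      (∀ i, rel i = (· ≤ ·) ∨ rel i = (· ≥ ·) ∨ rel i = (· = ·)) ∧
      ∀ Feas : Set (Matrix (Fin n) (Fin n) ℝ),
        Feas = {X | X.IsSymm ∧ (∀ i, rel i ((A i)ᵀ * X).trace (b i)) ∧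
          X.trace ≤ (d : ℝ) ∧ X.PosSemidef ∧
          ((1 : Matrix (Fin n) (Fin n) ℝ) - X).PosSemidef} →
        Feas.Nonempty ∧
        ∀ X ∈ Feas, (∀ Y ∈ Feas, (Cᵀ * X).trace ≤ (Cᵀ * Y).trace) →
          d + s ≤ X.rank := by
  have hn : d + s ≤ n := by omega
  have hn' : s + 1 ≤ n := by omega
  let T : Matrix (Fin n) (Fin n) ℝ := diagonal fun k => optimalDiag d s k
  let ε : Fin (s + 1) → Fin n := Fin.castLE hn'
  let e : Fin ((s + 1) * (s + 2) / 2 - 1) ≃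
      {w : Sym2 (Fin (s + 1)) // w ≠ s(Fin.last s, Fin.last s)} :=
    (Fintype.equivFinOfCardEq (by rw [Sym2.card_ne, Fintype.card_fin])).symm
  let p k := (Quot.out (e k).1 : Fin (s + 1) × Fin (s + 1))
  have hcost (Y : Matrix (Fin n) (Fin n) ℝ) :
      ((diagonal fun k : Fin n => -rewardDiag d s k)ᵀ * Y).trace =
        -∑ i : Fin n, rewardDiag d s i * Y i i := by
    simp [trace, diagonal_transpose, diagonal_mul]
  refine ⟨fun k => single (ε (p k).1) (ε (p k).2) 1, diagonal fun k => -rewardDiag d s k,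
    fun k => T (ε (p k).1) (ε (p k).2), fun _ => (· = ·), fun _ => .inr (.inr rfl), ?_⟩
  rintro Feas rfl
  have hT : T ∈ {X : Matrix (Fin n) (Fin n) ℝ | X.IsSymm ∧
      (∀ k, ((single (ε (p k).1) (ε (p k).2) (1 : ℝ))ᵀ * X).trace =
        T (ε (p k).1) (ε (p k).2)) ∧
      X.trace ≤ (d : ℝ) ∧ X.PosSemidef ∧ ((1 : Matrix (Fin n) (Fin n) ℝ) - X).PosSemidef} := by
    refine ⟨diagonal_transpose _, fun k => by simp [trace_single_mul], ?_, ?_, ?_⟩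
    · rw [trace_diagonal, sum_optimalDiag hd hn]
    · exact posSemidef_diagonal_iff.2 fun i => optimalDiag_nonneg d s i
    · rw [← diagonal_one, diagonal_sub]
      exact posSemidef_diagonal_iff.2 fun i => sub_nonneg.2 (optimalDiag_le_one d s i)
  refine ⟨⟨T, hT⟩, ?_⟩
  rintro X ⟨hsymm, hcon, htr, hX, hX1⟩ hopt
  refine rank_ge_of_reward_le hd hn hX hX1 htr (fun i j hi hj hij => ?_) ?_
  · have hne : s((⟨i, hi⟩ : Fin (s + 1)), ⟨j, hj⟩) ≠ s(Fin.last s, Fin.last s) := by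
      simpa [Sym2.eq_iff, Fin.ext_iff] using hij
    have hk := hcon (e.symm ⟨_, hne⟩)
    have hp : s((p (e.symm ⟨_, hne⟩)).1, (p (e.symm ⟨_, hne⟩)).2) =
        s((⟨i, hi⟩ : Fin (s + 1)), ⟨j, hj⟩) := by
      simp only [p, Equiv.apply_symm_apply]
      exact Quot.out_eq _
    simp only [transpose_single, trace_single_mul, one_smul] at hk
    rcases Sym2.eq_iff.1 hp with ⟨h1, h2⟩ | ⟨h1, h2⟩
    · rw [h1, h2] at hk
      exact hk
    · rw [h1, h2] at hk
      rw [← hsymm.apply, ← (diagonal_transpose _ : Tᵀ = T)]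
      exact hk
  · have hle := hopt T hT
    rw [hcost, hcost] at hle
    simpa [T] using hle
end
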